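/- Let J ⊆ A(𝔻) be a closed ideal with J ≠ {0}. Then there exist an inner function ω ∈ H^∞(𝔻) and a closed set K ⊆ ∂𝔻 of Lebesgue (arc-length) measure zero containing the support X_ω of ω, such that J = {f ∈ A(𝔻) : f(ζ) = 0 for every ζ ∈ K, and the restriction of f to 𝔻 belongs to ω·H^∞(𝔻)}. -/

import Mathlib

open MeasureTheory Metric Set Filter Topology

noncomputable section

/-- The closed unit disc in `ℂ`. -/
abbrev CD : Set ℂ := Metric.closedBall 0 1

instance : CompactSpace CD :=
  isCompact_iff_compactSpace.mp (isCompact_closedBall _ _)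

/-- The algebra of polynomial functions on the closed disc, generated by the
coordinate function `z`. -/
def discPoly : Subalgebra ℂ C(CD, ℂ) :=
  Algebra.adjoin ℂ {(⟨fun z => (z : ℂ), continuous_subtype_val⟩ : C(CD, ℂ))}

/-- The disc algebra `A(𝔻)`: the sup-norm closure of the polynomials in `C(cl(𝔻), ℂ)`. -/
def discAlg : Set C(CD, ℂ) := closure (discPoly : Set C(CD, ℂ))

/-- A closed ideal of the disc algebra. -/
structure IsClosedIdealD (J : Set C(CD, ℂ)) : Prop where
  subset : J ⊆ discAlg
  closed : IsClosed J
  zero_mem : (0 : C(CD, ℂ)) ∈ J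
  add_mem : ∀ f ∈ J, ∀ g ∈ J, f + g ∈ J
  smul_mem : ∀ (c : ℂ), ∀ f ∈ J, c • f ∈ J
  mul_mem : ∀ f ∈ discAlg, ∀ g ∈ J, f * g ∈ J

/-- Membership in `H^∞(𝔻)`: bounded holomorphic on the open unit disc. -/
def IsHinf (h : ℂ → ℂ) : Prop :=
  DifferentiableOn ℂ h (Metric.ball 0 1) ∧
    ∃ C : ℝ, ∀ z ∈ Metric.ball (0 : ℂ) 1, ‖h z‖ ≤ C

/-- An inner function: a bounded holomorphic function on `𝔻` whose radial limits have
modulus `1` at Lebesgue-almost every boundary point. -/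
def IsInner (ω : ℂ → ℂ) : Prop :=
  IsHinf ω ∧
    ∀ᵐ θ : ℝ ∂(volume.restrict (Set.Ico 0 (2 * Real.pi))),
      Tendsto (fun r : ℝ => ‖ω ((r : ℂ) * Complex.exp (θ * Complex.I))‖)
        (nhdsWithin 1 (Set.Iio 1)) (nhds 1)

/-- The support of an inner function: boundary points across which it cannot be
continued holomorphically. -/
def innerSupport (ω : ℂ → ℂ) : Set ℂ :=
  {ζ | ζ ∈ Metric.sphere (0 : ℂ) 1 ∧
    ¬ ∃ U : Set ℂ, IsOpen U ∧ ζ ∈ U ∧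
        ∃ g : ℂ → ℂ, DifferentiableOn ℂ g U ∧
          ∀ z ∈ U ∩ Metric.ball (0 : ℂ) 1, g z = ω z}

instance fact_two_pi_pos : Fact (0 < 2 * Real.pi) := ⟨Real.two_pi_pos⟩

/-- The unit circle, parametrised by angle. -/
abbrev Torus := AddCircle (2 * Real.pi)

/-- Normalised arc length. -/
abbrev arcM : Measure Torus := AddCircle.haarAddCircle

/-- The inclusion of the unit circle in the closed disc. -/
def bdry : C(Torus, CD) :=
  ⟨fun x => ⟨(AddCircle.toCircle x : ℂ), by
    rw [mem_closedBall_zero_iff, Circle.norm_coe]⟩, by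
    have := AddCircle.continuous_toCircle (T := 2 * Real.pi)
    fun_prop⟩

/-- Restriction of continuous functions on the closed disc to the circle. -/
def res : C(CD, ℂ) →ₐ[ℂ] C(Torus, ℂ) := ContinuousMap.compRightAlgHom ℂ ℂ bdry

/-- The coordinate function on the closed disc. -/
def coordD : C(CD, ℂ) := ⟨fun z => (z : ℂ), continuous_subtype_val⟩

/-- The disc algebra as a subalgebra. -/
def discSub : Subalgebra ℂ C(CD, ℂ) := discPoly.topologicalClosure

lemma mem_discSub {f : C(CD, ℂ)} : f ∈ discSub ↔ f ∈ discAlg := Iff.rfl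

lemma isClosed_discSub : IsClosed (discSub : Set C(CD, ℂ)) :=
  Subalgebra.isClosed_topologicalClosure _

lemma coordD_mem : coordD ∈ discSub :=
  Subalgebra.le_topologicalClosure _ (Algebra.subset_adjoin rfl)

lemma continuous_res : Continuous res := ContinuousMap.compRightAlgHom_continuous _ _ _

lemma res_apply (f : C(CD, ℂ)) (x : Torus) : res f x = f (bdry x) := rfl

lemma res_coordD : res coordD = fourier 1 := by
  ext x
  rw [fourier_one]; rfl

lemma discAlg_induction {p : C(CD, ℂ) → Prop} (hcl : IsClosed {f | p f}) (one : p 1)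
    (coord : ∀ f ∈ discAlg, p f → p (coordD * f)) (hadd : ∀ f g, p f → p g → p (f + g))
    (smul : ∀ (c : ℂ) f, p f → p (c • f)) : ∀ f ∈ discAlg, p f := by
  have key : (discPoly : Set C(CD, ℂ)) ⊆ {f | p f} := by
    intro f hf
    have hf' : f ∈ Algebra.adjoin ℂ {coordD} := hf
    rw [Algebra.adjoin_singleton_eq_range_aeval] at hf'
    obtain ⟨q, rfl⟩ := hf'
    show p (Polynomial.aeval coordD q)
    induction q using Polynomial.induction_on' with
    | add q r hq hr =>
      rw [map_add]
      refine hadd _ _ (hq ?_) (hr ?_) <;>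
      · show _ ∈ Algebra.adjoin ℂ {coordD}
        rw [Algebra.adjoin_singleton_eq_range_aeval]; exact ⟨_, rfl⟩
    | monomial n a =>
      rw [Polynomial.aeval_monomial, ← Algebra.smul_def]
      refine smul _ _ ?_
      clear hf
      induction n with
      | zero => simpa using one
      | succ n ih =>
        rw [pow_succ']
        exact coord _ (pow_mem coordD_mem n) ih
  intro f hf
  exact closure_minimal key hcl hf

section Pairing

variable {X : Type*} [TopologicalSpace X] [CompactSpace X] [MeasurableSpace X] [BorelSpace X]

lemma integrable_continuous_mul {μ : Measure X} {G : X → ℂ} (hG : Integrable G μ)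
    (φ : C(X, ℂ)) : Integrable (fun x => φ x * G x) μ :=
  hG.bdd_mul (c := ‖φ‖) φ.continuous.measurable.aestronglyMeasurable
    (Eventually.of_forall fun x => φ.norm_coe_le_norm x)

/-- The functional `φ ↦ ∫ φ G dμ` on continuous functions. -/
def pairing (μ : Measure X) (G : X → ℂ) (hG : Integrable G μ) : C(X, ℂ) →L[ℂ] ℂ :=
  LinearMap.mkContinuous
    { toFun := fun φ => ∫ x, φ x * G x ∂μ
      map_add' := fun φ ψ => by
        simp only [ContinuousMap.add_apply, add_mul]
        exact integral_add (integrable_continuous_mul hG φ) (integrable_continuous_mul hG ψ)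
      map_smul' := fun c φ => by
        simp only [ContinuousMap.smul_apply, smul_eq_mul, mul_assoc, RingHom.id_apply]
        exact integral_const_mul _ _ }
    (∫ x, ‖G x‖ ∂μ) (fun φ => by
      simp only [LinearMap.coe_mk, AddHom.coe_mk]
      refine (norm_integral_le_integral_norm _).trans ?_
      rw [mul_comm, ← integral_const_mul]
      refine integral_mono_of_nonneg (Eventually.of_forall fun x => norm_nonneg _)
        (hG.norm.const_mul _) (Eventually.of_forall fun x => ?_)
      simp only [norm_mul]
      gcongr
      exact φ.norm_coe_le_norm x)

lemma pairing_apply (μ : Measure X) (G : X → ℂ) (hG : Integrable G μ) (φ : C(X, ℂ)) :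
    pairing μ G hG φ = ∫ x, φ x * G x ∂μ := rfl

end Pairing

/-- The conjugate Cauchy kernel `x ↦ 1 / (1 - w * conj x)`. -/
def cker (w : ℂ) : C(Torus, ℂ) := Ring.inverse (1 - w • fourier (-1))

lemma norm_smul_fourier_lt {w : ℂ} (hw : ‖w‖ < 1) (n : ℤ) :
    ‖w • (fourier n : C(Torus, ℂ))‖ < 1 := by
  rw [norm_smul, fourier_norm, mul_one]; exact hw

lemma isUnit_one_sub_smul_fourier {w : ℂ} (hw : ‖w‖ < 1) (n : ℤ) :
    IsUnit (1 - w • (fourier n : C(Torus, ℂ))) :=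
  (Units.oneSub _ (norm_smul_fourier_lt hw n)).isUnit

lemma cker_mul {w : ℂ} (hw : ‖w‖ < 1) (x : Torus) :
    cker w x * (1 - w * fourier (-1) x) = 1 := by
  have := congrArg (fun φ : C(Torus, ℂ) => φ x)
    (Ring.inverse_mul_cancel _ (isUnit_one_sub_smul_fourier hw (-1)))
  simpa [cker] using this

lemma fourier_one_mul_neg (x : Torus) : (fourier 1 x : ℂ) * fourier (-1) x = 1 := by
  rw [← fourier_add]; simp

lemma fourier_mul_cker {w : ℂ} (hw : ‖w‖ < 1) (x : Torus) :
    fourier 1 x * cker w x = w * cker w x + fourier 1 x := by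
  have h1 := cker_mul hw x
  have h2 := fourier_one_mul_neg x
  linear_combination fourier 1 x * h1 + w * cker w x * h2

/-- Extension of a function on the circle to the disc by the Cauchy integral. -/
def cext (F : Torus → ℂ) (w : ℂ) : ℂ := ∫ x, cker w x * F x ∂arcM

/-- Integrable functions whose Fourier coefficients of negative index vanish. -/
structure AnalyticOnCircle (F : Torus → ℂ) : Prop where
  integrable : Integrable F arcM
  coeff : ∀ n : ℕ, ∫ x, fourier (n + 1 : ℤ) x * F x ∂arcM = 0

lemma differentiableOn_cext {F : Torus → ℂ} (hF : Integrable F arcM) :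
    DifferentiableOn ℂ (cext F) (ball 0 1) := by
  intro w hw
  have hw' : ‖w‖ < 1 := by simpa using hw
  apply DifferentiableAt.differentiableWithinAt
  have : cext F = fun w => pairing arcM F hF (cker w) := rfl
  rw [this]
  refine (pairing arcM F hF).differentiableAt.comp w ?_
  unfold cker
  exact DifferentiableAt.comp (f := fun w : ℂ => 1 - w • (fourier (-1) : C(Torus, ℂ))) w
    (differentiableAt_inverse (isUnit_one_sub_smul_fourier hw' (-1))) (by fun_prop)

lemma AnalyticOnCircle.res_mul {F : Torus → ℂ} (hF : AnalyticOnCircle F) :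
    ∀ a ∈ discAlg, AnalyticOnCircle (fun x => res a x * F x) := by
  intro a ha
  refine ⟨integrable_continuous_mul hF.integrable _, fun n => ?_⟩
  have key : ∀ a ∈ discAlg, ∀ n : ℕ, pairing arcM F hF.integrable (fourier (n + 1) * res a) = 0 := by
    refine discAlg_induction ?_ ?_ ?_ ?_ ?_
    · simp only [Set.ofPred_forall]
      refine isClosed_iInter fun n => isClosed_eq ?_ continuous_const
      exact (pairing arcM F hF.integrable).continuous.comp
        (continuous_const.mul continuous_res)
    · intro n
      simpa [pairing_apply] using hF.coeff n
    · intro f _ hf n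
      rw [← hf (n + 1)]
      congr 1; ext x
      simp only [map_mul, res_coordD, ContinuousMap.mul_apply]
      rw [← mul_assoc, ← fourier_add]; push_cast; rfl
    · intro f g hf hg n
      rw [map_add, mul_add, map_add, hf, hg, add_zero]
    · intro c f hf n
      rw [map_smul, mul_smul_comm, map_smul, hf, smul_zero]
  rw [← key a ha n, pairing_apply]
  simp [mul_assoc]

lemma cext_res_mul {F : Torus → ℂ} (hF : AnalyticOnCircle F) {w : ℂ} (hw : ‖w‖ < 1) :
    ∀ a ∈ discAlg, cext (fun x => res a x * F x) w = a ⟨w, by simpa using hw.le⟩ * cext F w := by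
  intro a ha
  have key : ∀ a ∈ discAlg, pairing arcM F hF.integrable (cker w * res a) =
      a ⟨w, by simpa using hw.le⟩ * cext F w := by
    refine discAlg_induction ?_ ?_ ?_ ?_ ?_
    · refine isClosed_eq ((pairing arcM F hF.integrable).continuous.comp
        (continuous_const.mul continuous_res)) ?_
      exact (continuous_eval_const _).mul continuous_const
    · simp [pairing_apply, cext]
    · intro f hfA hf
      have h0 : ∫ x, (fourier 1 * res f : C(Torus, ℂ)) x * F x ∂arcM = 0 := by
        have := (hF.res_mul f hfA).coeff 0
        simpa [mul_assoc] using this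
      have h1 : cker w * res (coordD * f) = w • (cker w * res f) + fourier 1 * res f := by
        ext x
        simp only [map_mul, res_coordD, ContinuousMap.mul_apply, ContinuousMap.add_apply,
          ContinuousMap.smul_apply, smul_eq_mul]
        linear_combination res f x * fourier_mul_cker hw x
      rw [h1, map_add, map_smul, hf, pairing_apply _ _ _ (fourier 1 * res f), h0, add_zero,
        ContinuousMap.mul_apply, smul_eq_mul, mul_assoc]
      rfl
    · intro f g hf hg
      rw [map_add, mul_add, map_add, hf, hg, ContinuousMap.add_apply, add_mul]
    · intro c f hf
      rw [map_smul, mul_smul_comm, map_smul, hf, ContinuousMap.smul_apply, smul_eq_mul,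
        smul_eq_mul, mul_assoc]
  rw [← key a ha, pairing_apply]
  simp [cext, mul_assoc]

lemma integral_fourier_of_ne {n : ℤ} (hn : n ≠ 0) :
    ∫ x, (fourier n x : ℂ) ∂(arcM) = 0 := by
  have := fourierCoeff_fourier (T := 2 * Real.pi) n
  have h := congrFun this 0
  rw [fourierCoeff, Pi.single_eq_of_ne hn.symm] at h
  simpa using h

lemma integrable_continuous (φ : C(Torus, ℂ)) : Integrable φ arcM :=
  φ.continuous.integrable_of_hasCompactSupport (HasCompactSupport.of_compactSpace _)

lemma analyticOnCircle_one : AnalyticOnCircle (fun _ => 1) where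
  integrable := integrable_const _
  coeff n := by
    simp only [mul_one]
    exact integral_fourier_of_ne (by positivity)

lemma analyticOnCircle_res {a : C(CD, ℂ)} (ha : a ∈ discAlg) : AnalyticOnCircle (res a) := by
  simpa using analyticOnCircle_one.res_mul a ha

lemma integral_res : ∀ a ∈ discAlg, ∫ x, res a x ∂arcM = a ⟨0, by simp⟩ := by
  intro a ha
  have key : ∀ a ∈ discAlg, pairing arcM (fun _ => 1) (integrable_const _) (res a) =
      a ⟨0, by simp⟩ := by
    refine discAlg_induction ?_ ?_ ?_ ?_ ?_
    · exact isClosed_eq ((pairing _ _ _).continuous.comp continuous_res) (continuous_eval_const _)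
    · simp [pairing_apply]
    · intro f hf _
      have := (analyticOnCircle_res hf).coeff 0
      simp only [Nat.cast_zero, zero_add] at this
      simp only [map_mul, pairing_apply, mul_one, ContinuousMap.mul_apply, res_coordD, this]
      simp [coordD]
    · intro f g hf hg; simp only [map_add, hf, hg, ContinuousMap.add_apply]
    · intro c f hf; simp only [map_smul, hf, ContinuousMap.smul_apply]
  rw [← key a ha, pairing_apply]; simp

lemma inverse_one_sub_mem {A : Type*} [NormedRing A] [NormedAlgebra ℂ A] [CompleteSpace A]
    {S : Subalgebra ℂ A} (hS : IsClosed (S : Set A)) {t : A} (ht : t ∈ S) (h : ‖t‖ < 1) :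
    Ring.inverse (1 - t) ∈ S := by
  have h1 : Ring.inverse (1 - t) = ∑' i : ℕ, t ^ i := NormedRing.inverse_one_sub t h
  rw [h1]
  exact hS.mem_of_tendsto (summable_geometric_of_norm_lt_one h).hasSum
    (Eventually.of_forall fun s => sum_mem fun i _ => pow_mem ht i)

lemma exp_mem_discAlg {a : C(CD, ℂ)} (ha : a ∈ discAlg) : NormedSpace.exp a ∈ discAlg := by
  rw [NormedSpace.exp_eq_tsum ℂ]
  exact isClosed_discSub.mem_of_tendsto (NormedSpace.expSeries_summable' (𝕂 := ℂ) a).hasSum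
    (Eventually.of_forall fun s => sum_mem (S := discSub) fun i _ =>
      Subalgebra.smul_mem _ (pow_mem (S := discSub) ha i) _)

lemma exp_continuousMap_apply {X : Type*} [TopologicalSpace X] [CompactSpace X] (a : C(X, ℂ))
    (z : X) : NormedSpace.exp a z = Complex.exp (a z) := by
  have := NormedSpace.map_exp (ContinuousMap.evalAlgHom ℂ ℂ z) (continuous_eval_const z) a
  rw [Complex.exp_eq_exp_ℂ]
  exact this

lemma norm_coordD_le : ‖coordD‖ ≤ 1 := by
  rw [ContinuousMap.norm_le _ zero_le_one]
  exact fun z => mem_closedBall_zero_iff.mp z.2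

/-- The Cauchy kernel as an element of the disc algebra. -/
def dker (w : ℂ) : C(CD, ℂ) := Ring.inverse (1 - (starRingEnd ℂ w) • coordD)

lemma norm_smul_coordD_lt {w : ℂ} (hw : ‖w‖ < 1) : ‖(starRingEnd ℂ w) • coordD‖ < 1 := by
  rw [norm_smul, RCLike.norm_conj]
  nlinarith [norm_coordD_le, norm_nonneg w, norm_nonneg coordD]

lemma dker_mem {w : ℂ} (hw : ‖w‖ < 1) : dker w ∈ discAlg :=
  inverse_one_sub_mem isClosed_discSub (Subalgebra.smul_mem _ coordD_mem _)
    (norm_smul_coordD_lt hw)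

lemma dker_mul {w : ℂ} (hw : ‖w‖ < 1) (z : CD) :
    dker w z * (1 - starRingEnd ℂ w * z) = 1 := by
  have := congrArg (fun φ : C(CD, ℂ) => φ z)
    (Ring.inverse_mul_cancel _ (Units.oneSub _ (norm_smul_coordD_lt hw)).isUnit)
  simpa [dker, coordD] using this

lemma res_dker {w : ℂ} (hw : ‖w‖ < 1) (x : Torus) :
    res (dker w) x = starRingEnd ℂ (cker w x) := by
  have h1 := dker_mul hw (bdry x)
  have h2 := congrArg (starRingEnd ℂ) (cker_mul hw x)
  have h3 : ((bdry x : CD) : ℂ) = fourier 1 x := by rw [fourier_one]; rfl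
  rw [← res_apply, h3] at h1
  simp only [map_mul, map_sub, map_one, fourier_neg, Complex.conj_conj] at h2
  have h4 : (1 - starRingEnd ℂ w * fourier 1 x) ≠ 0 := fun h => by
    rw [h, mul_zero] at h1; exact zero_ne_one h1
  exact mul_right_cancel₀ h4 (h1.trans h2.symm)

lemma cext_one {w : ℂ} (hw : ‖w‖ < 1) : cext (fun _ => 1) w = 1 := by
  have h1 := integral_res _ (dker_mem hw)
  have h2 := dker_mul hw ⟨0, by simp⟩
  simp only [mul_zero, sub_zero, mul_one] at h2
  rw [h2] at h1
  simp only [res_dker hw, integral_conj] at h1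
  have h3 := congrArg (starRingEnd ℂ) h1
  simpa [cext] using h3

lemma cext_res {a : C(CD, ℂ)} (ha : a ∈ discAlg) {w : ℂ} (hw : ‖w‖ < 1) :
    cext (res a) w = a ⟨w, by simpa using hw.le⟩ := by
  have := cext_res_mul analyticOnCircle_one hw a ha
  simpa [cext_one hw] using this

lemma integral_norm_cker_sq {w : ℂ} (hw : ‖w‖ < 1) :
    ((∫ x, ‖cker w x‖ ^ 2 ∂arcM : ℝ) : ℂ) = dker w ⟨w, by simpa using hw.le⟩ := by
  rw [← cext_res (dker_mem hw) hw, cext, ← integral_complex_ofReal]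
  congr 1; ext x
  rw [res_dker hw, Complex.mul_conj, Complex.normSq_eq_norm_sq]

lemma norm_cext_le {F : Torus → ℂ} (hF : AnalyticOnCircle F) {C : ℝ}
    (hC : ∀ᵐ x ∂arcM, ‖F x‖ ≤ C) {w : ℂ} (hw : ‖w‖ < 1) : ‖cext F w‖ ≤ C := by
  have h1 := cext_res_mul hF hw _ (dker_mem hw)
  have h2 := dker_mul hw ⟨w, by simpa using hw.le⟩
  have h3 : dker w ⟨w, by simpa using hw.le⟩ ≠ 0 := fun h => by
    rw [h, zero_mul] at h2; exact zero_ne_one h2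
  have h4 := integral_norm_cker_sq hw
  have hI0 : 0 ≤ ∫ x, ‖cker w x‖ ^ 2 ∂arcM := integral_nonneg fun x => by positivity
  rw [← h4] at h1 h3
  have h5 : ‖cext (fun x => res (dker w) x * F x) w‖ ≤ (∫ x, ‖cker w x‖ ^ 2 ∂arcM) * C := by
    rw [cext, ← integral_mul_const]
    refine (norm_integral_le_integral_norm _).trans ?_
    refine integral_mono_of_nonneg (Eventually.of_forall fun x => norm_nonneg _) ?_ ?_
    · refine Integrable.mul_const ?_ _
      exact Continuous.integrable_of_hasCompactSupport (by fun_prop)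
        (HasCompactSupport.of_compactSpace _)
    · filter_upwards [hC] with x hx
      rw [res_dker hw]
      simp only [norm_mul, RCLike.norm_conj]
      rw [← mul_assoc, ← sq]
      gcongr
  rw [h1, norm_mul, Complex.norm_real, Real.norm_of_nonneg hI0] at h5
  have hpos : 0 < ∫ x, ‖cker w x‖ ^ 2 ∂arcM :=
    lt_of_le_of_ne hI0 fun h => h3 (by rw [← h]; simp)
  exact le_of_mul_le_mul_left h5 hpos

lemma exists_bdry_eq (z : CD) (hz : ‖(z : ℂ)‖ = 1) : ∃ x, bdry x = z := by
  refine ⟨(Complex.arg z : ℝ), Subtype.ext ?_⟩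
  show (AddCircle.toCircle (Complex.arg z : Torus) : ℂ) = z
  rw [AddCircle.toCircle_apply_mk]
  have := Complex.norm_mul_exp_arg_mul_I z
  rw [hz] at this
  simpa [Circle.coe_exp] using this

lemma norm_apply_le_norm_res {a : C(CD, ℂ)} (ha : a ∈ discAlg) (z : CD) : ‖a z‖ ≤ ‖res a‖ := by
  have hz : ‖(z : ℂ)‖ ≤ 1 := mem_closedBall_zero_iff.mp z.2
  rcases hz.lt_or_eq with h | h
  · have := norm_cext_le (analyticOnCircle_res ha) (C := ‖res a‖)
      (Eventually.of_forall fun x => (res a).norm_coe_le_norm x) h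
    rwa [cext_res ha h] at this
  · obtain ⟨x, rfl⟩ := exists_bdry_eq z h
    exact (res a).norm_coe_le_norm x

lemma norm_res {a : C(CD, ℂ)} (ha : a ∈ discAlg) : ‖res a‖ = ‖a‖ := by
  apply le_antisymm
  · rw [ContinuousMap.norm_le _ (norm_nonneg _)]
    exact fun x => a.norm_coe_le_norm _
  · rw [ContinuousMap.norm_le _ (norm_nonneg _)]
    exact norm_apply_le_norm_res ha

section ComplexRiesz

open scoped NNReal CompactlySupported

variable {X : Type*} [TopologicalSpace X] [CompactSpace X]

/-- Total variation of a functional on continuous functions, evaluated at a function `φ ≥ 0`. -/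
def variationAt (ℓ : C(X, ℂ) →L[ℂ] ℂ) (φ : X → ℝ≥0) : ℝ≥0 :=
  sSup ((fun ψ => ‖ℓ ψ‖₊) '' {ψ | ∀ x, ‖ψ x‖₊ ≤ φ x})

lemma bddAbove_variationAt (ℓ : C(X, ℂ) →L[ℂ] ℂ) {φ : X → ℝ≥0} (hφ : Continuous φ) :
    BddAbove ((fun ψ => ‖ℓ ψ‖₊) '' {ψ | ∀ x, ‖ψ x‖₊ ≤ φ x}) := by
  obtain ⟨C, hC⟩ := (isCompact_range hφ).bddAbove
  refine ⟨‖ℓ‖₊ * C, ?_⟩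
  rintro _ ⟨ψ, hψ, rfl⟩
  refine (ℓ.le_opNNNorm ψ).trans ?_
  gcongr
  have : ‖ψ‖ ≤ C := (ContinuousMap.norm_le _ C.2).2 fun x =>
    NNReal.coe_le_coe.2 ((hψ x).trans (hC ⟨x, rfl⟩))
  exact_mod_cast this

lemma le_variationAt (ℓ : C(X, ℂ) →L[ℂ] ℂ) {φ : X → ℝ≥0} (hφ : Continuous φ) {ψ : C(X, ℂ)}
    (h : ∀ x, ‖ψ x‖₊ ≤ φ x) : ‖ℓ ψ‖₊ ≤ variationAt ℓ φ :=
  le_csSup (bddAbove_variationAt ℓ hφ) ⟨ψ, h, rfl⟩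

omit [CompactSpace X] in
lemma variationAt_le (ℓ : C(X, ℂ) →L[ℂ] ℂ) {φ : X → ℝ≥0} {C : ℝ≥0}
    (h : ∀ ψ : C(X, ℂ), (∀ x, ‖ψ x‖₊ ≤ φ x) → ‖ℓ ψ‖₊ ≤ C) : variationAt ℓ φ ≤ C := by
  refine csSup_le ⟨_, 0, fun x => ?_, rfl⟩ ?_
  · simp
  · rintro _ ⟨ψ, hψ, rfl⟩
    exact h ψ hψ

lemma exists_unit_mul_eq_norm (z : ℂ) : ∃ c : ℂ, ‖c‖ = 1 ∧ c * z = ‖z‖ := by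
  by_cases hz : z = 0
  · exact ⟨1, by simp, by simp [hz]⟩
  · have : (‖z‖ : ℂ) ≠ 0 := by simpa using hz
    refine ⟨‖z‖ / z, ?_, by field_simp⟩
    rw [norm_div, Complex.norm_real, norm_norm, div_self (by simpa using hz)]

lemma variationAt_add (ℓ : C(X, ℂ) →L[ℂ] ℂ) {φ₁ φ₂ : X → ℝ≥0} (h₁ : Continuous φ₁)
    (h₂ : Continuous φ₂) :
    variationAt ℓ (φ₁ + φ₂) = variationAt ℓ φ₁ + variationAt ℓ φ₂ := by
  apply le_antisymm
  · refine variationAt_le ℓ fun ψ hψ => ?_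
    refine le_of_forall_pos_le_add fun δ hδ => ?_
    obtain ⟨ε, hε, hεδ⟩ : ∃ ε : ℝ≥0, 0 < ε ∧ ‖ℓ‖₊ * ε ≤ δ := by
      refine ⟨δ / (‖ℓ‖₊ + 1), by positivity, ?_⟩
      rw [← mul_div_assoc, div_le_iff₀ (by positivity), mul_comm]
      gcongr
      exact le_self_add
    have hden : ∀ x, ((φ₁ x + φ₂ x + ε : ℝ≥0) : ℂ) ≠ 0 := fun x => by
      have : (φ₁ x + φ₂ x + ε : ℝ≥0) ≠ 0 := by positivity
      exact_mod_cast this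
    let part (θ : X → ℝ≥0) (hθ : Continuous θ) : C(X, ℂ) :=
      ⟨fun x => ψ x * ((θ x : ℝ≥0) : ℂ) / ((φ₁ x + φ₂ x + ε : ℝ≥0) : ℂ), by
        refine Continuous.div ?_ ?_ hden
        · exact ψ.continuous.mul (Complex.continuous_ofReal.comp
            (NNReal.continuous_coe.comp hθ))
        · exact Complex.continuous_ofReal.comp (NNReal.continuous_coe.comp
            ((h₁.add h₂).add continuous_const))⟩
    have hpart : ∀ θ hθ x, ‖part θ hθ x‖₊ ≤ θ x := fun θ hθ x => by
      have : ‖part θ hθ x‖₊ = ‖ψ x‖₊ * θ x / (φ₁ x + φ₂ x + ε) := by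
        apply NNReal.eq
        simp only [part, ContinuousMap.coe_mk, coe_nnnorm, norm_div, norm_mul, Complex.norm_real,
          Real.norm_of_nonneg (NNReal.coe_nonneg _)]
        push_cast
        rfl
      rw [this, div_le_iff₀ (by positivity), mul_comm]
      gcongr
      exact (hψ x).trans le_self_add
    have hsum : ψ = part φ₁ h₁ + part φ₂ h₂ + part (fun _ => ε) continuous_const := by
      ext x
      simp only [part, ContinuousMap.add_apply, ContinuousMap.coe_mk]
      have := hden x
      field_simp
      push_cast
      ring
    calc ‖ℓ ψ‖₊ ≤ ‖ℓ (part φ₁ h₁)‖₊ + ‖ℓ (part φ₂ h₂)‖₊ +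
          ‖ℓ (part (fun _ => ε) continuous_const)‖₊ := by
            conv_lhs => rw [hsum]
            rw [map_add, map_add]
            exact (nnnorm_add_le _ _).trans (add_le_add_left (nnnorm_add_le _ _) _)
      _ ≤ variationAt ℓ φ₁ + variationAt ℓ φ₂ + δ := by
            gcongr
            · exact le_variationAt ℓ h₁ (hpart φ₁ h₁)
            · exact le_variationAt ℓ h₂ (hpart φ₂ h₂)
            · refine (ℓ.le_opNNNorm _).trans (le_trans ?_ hεδ)
              gcongr
              have : ‖part (fun _ => ε) continuous_const‖ ≤ ε :=
                (ContinuousMap.norm_le _ ε.2).2 fun x => NNReal.coe_le_coe.2 (hpart _ continuous_const x)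
              exact_mod_cast this
  · have key : ∀ ψ₁ ψ₂ : C(X, ℂ), (∀ x, ‖ψ₁ x‖₊ ≤ φ₁ x) → (∀ x, ‖ψ₂ x‖₊ ≤ φ₂ x) →
        ‖ℓ ψ₁‖₊ + ‖ℓ ψ₂‖₊ ≤ variationAt ℓ (φ₁ + φ₂) := by
      intro ψ₁ ψ₂ hψ₁ hψ₂
      obtain ⟨c₁, hc₁, hc₁'⟩ := exists_unit_mul_eq_norm (ℓ ψ₁)
      obtain ⟨c₂, hc₂, hc₂'⟩ := exists_unit_mul_eq_norm (ℓ ψ₂)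
      have h : ‖ℓ (c₁ • ψ₁ + c₂ • ψ₂)‖₊ = ‖ℓ ψ₁‖₊ + ‖ℓ ψ₂‖₊ := by
        apply NNReal.eq
        rw [map_add, map_smul, map_smul, smul_eq_mul, smul_eq_mul, hc₁', hc₂', coe_nnnorm,
          ← Complex.ofReal_add, Complex.norm_real, Real.norm_of_nonneg (by positivity)]
        rfl
      rw [← h]
      refine le_variationAt ℓ (h₁.add h₂) fun x => ?_
      refine (nnnorm_add_le _ _).trans ?_
      have e₁ : ‖c₁‖₊ = 1 := NNReal.eq hc₁
      have e₂ : ‖c₂‖₊ = 1 := NNReal.eq hc₂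
      simp only [ContinuousMap.smul_apply, nnnorm_smul, e₁, e₂, one_mul]
      exact add_le_add (hψ₁ x) (hψ₂ x)
    rw [← NNReal.coe_le_coe, NNReal.coe_add, ← le_sub_iff_add_le]
    have step : ∀ ψ₂ : C(X, ℂ), (∀ x, ‖ψ₂ x‖₊ ≤ φ₂ x) →
        variationAt ℓ φ₁ ≤ variationAt ℓ (φ₁ + φ₂) - ‖ℓ ψ₂‖₊ := fun ψ₂ hψ₂ =>
      variationAt_le ℓ fun ψ₁ hψ₁ => le_tsub_of_add_le_right (key ψ₁ ψ₂ hψ₁ hψ₂)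
    rw [le_sub_comm]
    have hle : variationAt ℓ φ₁ ≤ variationAt ℓ (φ₁ + φ₂) := by
      simpa using step 0 (by simp)
    rw [← NNReal.coe_sub hle, NNReal.coe_le_coe]
    refine variationAt_le ℓ fun ψ₂ hψ₂ => ?_
    have h0 : ‖ℓ ψ₂‖₊ ≤ variationAt ℓ (φ₁ + φ₂) := le_variationAt ℓ (h₁.add h₂) fun x =>
      (hψ₂ x).trans le_add_self
    exact (le_tsub_iff_le_tsub hle h0).1 (step ψ₂ hψ₂)

lemma variationAt_smul (ℓ : C(X, ℂ) →L[ℂ] ℂ) (c : ℝ≥0) {φ : X → ℝ≥0} (h : Continuous φ) :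
    variationAt ℓ (c • φ) = c * variationAt ℓ φ := by
  have hle : ∀ (c : ℝ≥0) {φ : X → ℝ≥0}, Continuous φ →
      c * variationAt ℓ φ ≤ variationAt ℓ (c • φ) := by
    intro c φ h
    rcases eq_or_ne c 0 with rfl | hc
    · simp
    rw [mul_comm, ← le_div_iff₀ (by positivity)]
    refine variationAt_le ℓ fun ψ hψ => ?_
    rw [le_div_iff₀ (by positivity), mul_comm]
    have : c * ‖ℓ ψ‖₊ = ‖ℓ (((c : ℝ) : ℂ) • ψ)‖₊ := by
      rw [map_smul, nnnorm_smul]; congr 1; apply NNReal.eq; simp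
    rw [this]
    refine le_variationAt ℓ (h.const_smul c) fun x => ?_
    have hc' : ‖((c : ℝ) : ℂ)‖₊ = c := by apply NNReal.eq; simp
    simp only [ContinuousMap.smul_apply, Pi.smul_apply, smul_eq_mul, nnnorm_mul, hc']
    gcongr
    exact hψ x
  refine le_antisymm ?_ (hle c h)
  rcases eq_or_ne c 0 with rfl | hc
  · refine variationAt_le ℓ fun ψ hψ => ?_
    have : ψ = 0 := by ext x; simpa using hψ x
    simp [this]
  · have := hle c⁻¹ (h.const_smul c)
    rw [inv_smul_smul₀ hc] at this
    rwa [inv_mul_le_iff₀ (by positivity)] at this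

variable [MeasurableSpace X] [BorelSpace X]

lemma integral_norm_le_mul_norm_toLp (μ : Measure X) [IsFiniteMeasure μ] (ψ : C(X, ℂ)) :
    ∫ x, ‖ψ x‖ ∂μ ≤ ‖(ContinuousMap.toLp 2 μ ℂ (1 : C(X, ℂ)) : Lp ℂ 2 μ)‖ *
      ‖(ContinuousMap.toLp 2 μ ℂ ψ : Lp ℂ 2 μ)‖ := by
  let a : C(X, ℂ) := ⟨fun x => (‖ψ x‖ : ℂ), by fun_prop⟩
  have h1 := norm_inner_le_norm (𝕜 := ℂ) (ContinuousMap.toLp 2 μ ℂ (1 : C(X, ℂ)) : Lp ℂ 2 μ)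
    (ContinuousMap.toLp 2 μ ℂ a : Lp ℂ 2 μ)
  rw [ContinuousMap.inner_toLp] at h1
  have h2 : ∫ x, a x * (starRingEnd ℂ) ((1 : C(X, ℂ)) x) ∂μ = ((∫ x, ‖ψ x‖ ∂μ : ℝ) : ℂ) := by
    rw [← integral_complex_ofReal]; simp [a]
  rw [h2, Complex.norm_real, Real.norm_of_nonneg (integral_nonneg fun x => norm_nonneg _)] at h1
  refine h1.trans (mul_le_mul_of_nonneg_left ?_ (norm_nonneg _))
  refine Lp.norm_le_norm_of_ae_le ?_
  filter_upwards [ContinuousMap.coeFn_toLp (p := 2) (𝕜 := ℂ) μ a,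
    ContinuousMap.coeFn_toLp (p := 2) (𝕜 := ℂ) μ ψ] with x hx hx'
  rw [hx, hx']; simp [a]

variable [T2Space X]

lemma exists_measure_norm_le (ℓ : C(X, ℂ) →L[ℂ] ℂ) :
    ∃ μ : Measure X, IsFiniteMeasure μ ∧ μ.Regular ∧ ∀ ψ : C(X, ℂ), ‖ℓ ψ‖ ≤ ∫ x, ‖ψ x‖ ∂μ := by
  let Λ : C_c(X, ℝ≥0) →ₗ[ℝ≥0] ℝ≥0 :=
    { toFun := fun φ => variationAt ℓ φ
      map_add' := fun φ ψ => variationAt_add ℓ φ.continuous ψ.continuous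
      map_smul' := fun c φ => variationAt_smul ℓ c φ.continuous }
  have hreg : (NNRealRMK.rieszMeasure Λ).Regular := NNRealRMK.rieszMeasure_regular Λ
  refine ⟨NNRealRMK.rieszMeasure Λ, ⟨isCompact_univ.measure_lt_top⟩, hreg, fun ψ => ?_⟩
  let φ : C_c(X, ℝ≥0) := ⟨⟨fun x => ‖ψ x‖₊, by fun_prop⟩, HasCompactSupport.of_compactSpace _⟩
  have h1 := NNRealRMK.integral_rieszMeasure Λ φ
  have h2 : ‖ℓ ψ‖₊ ≤ Λ φ := le_variationAt ℓ φ.continuous fun x => le_rfl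
  calc ‖ℓ ψ‖ ≤ Λ φ := h2
    _ = _ := h1.symm

/-- Riesz representation of complex functionals on continuous functions, with a square integrable
density against a finite regular positive measure. -/
theorem exists_measure_density (ℓ : C(X, ℂ) →L[ℂ] ℂ) :
    ∃ (μ : Measure X) (u : X → ℂ), IsFiniteMeasure μ ∧ μ.Regular ∧ MemLp u 2 μ ∧
      ∀ φ : C(X, ℂ), ℓ φ = ∫ x, φ x * u x ∂μ := by
  obtain ⟨μ, hfin, hreg, hbound⟩ := exists_measure_norm_le ℓ
  let e : C(X, ℂ) →ₗ[ℂ] Lp ℂ 2 μ := (ContinuousMap.toLp 2 μ ℂ : C(X, ℂ) →L[ℂ] Lp ℂ 2 μ)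
  have hdense : DenseRange e := ContinuousMap.toLp_denseRange (p := 2) (μ := μ) (E := ℂ) ℂ (by simp)
  have hnorm : ∃ C, ∀ ψ : C(X, ℂ), ‖(ℓ : C(X, ℂ) →ₗ[ℂ] ℂ) ψ‖ ≤ C * ‖e ψ‖ :=
    ⟨_, fun ψ => (hbound ψ).trans (integral_norm_le_mul_norm_toLp μ ψ)⟩
  obtain ⟨L, hL⟩ : ∃ L : Lp ℂ 2 μ →L[ℂ] ℂ, ∀ ψ, L (e ψ) = ℓ ψ :=
    ⟨_, LinearMap.extendOfNorm_eq (f := (ℓ : C(X, ℂ) →ₗ[ℂ] ℂ)) hdense hnorm⟩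
  obtain ⟨v, rfl⟩ := (InnerProductSpace.toDual ℂ (Lp ℂ 2 μ)).surjective L
  refine ⟨μ, fun x => starRingEnd ℂ (v x), hfin, hreg, (Lp.memLp v).star, fun φ => ?_⟩
  rw [← hL, InnerProductSpace.toDual_apply_apply, L2.inner_def]
  apply integral_congr_ae
  filter_upwards [ContinuousMap.coeFn_toLp (p := 2) (𝕜 := ℂ) μ φ] with x hx
  have hx' : (e φ : Lp ℂ 2 μ) x = φ x := hx
  rw [hx']
  simp

end ComplexRiesz

lemma exists_discAlg_re_eq {t : C(Torus, ℂ)}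
    (ht : t ∈ Submodule.span ℂ (range (fourier : ℤ → C(Torus, ℂ)))) :
    ∃ P ∈ discAlg, (∀ x, (res P x).re = (t x).re) ∧ (P ⟨0, by simp⟩).im = 0 := by
  suffices h : ∀ c : ℂ, ∃ P ∈ discSub, (∀ x, (res P x).re = (c * t x).re) ∧
      (P ⟨0, by simp⟩).im = 0 by
    simpa [mem_discSub] using h 1
  induction ht using Submodule.span_induction with
  | mem t h =>
    obtain ⟨n, rfl⟩ := h
    intro c
    have hpow : ∀ (k : ℕ) x, res (coordD ^ k) x = fourier k x := fun k x => by
      rw [map_pow, res_coordD, ContinuousMap.pow_apply, fourier_apply, fourier_apply,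
        ← Circle.coe_pow, ← AddCircle.toCircle_nsmul]
      simp
    have hzero : ∀ k : ℕ, k ≠ 0 → (coordD ^ k) ⟨0, by simp⟩ = 0 := fun k hk => by
      simp [coordD, hk]
    rcases eq_or_ne n 0 with rfl | hn
    · refine ⟨algebraMap ℂ _ (c.re : ℂ), Subalgebra.algebraMap_mem _ _, fun x => ?_, ?_⟩
      · rw [AlgHom.commutes]
        simp
      · simp
    rcases le_total 0 n with h0 | h0
    · lift n to ℕ using h0
      refine ⟨c • coordD ^ n, Subalgebra.smul_mem _ (pow_mem coordD_mem _) _, fun x => ?_, ?_⟩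
      · rw [map_smul, ContinuousMap.smul_apply, hpow, smul_eq_mul]
      · rw [ContinuousMap.smul_apply, hzero n (by simpa using hn)]; simp
    · obtain ⟨k, rfl⟩ : ∃ k : ℕ, n = -k := ⟨n.natAbs, by omega⟩
      refine ⟨starRingEnd ℂ c • coordD ^ k, Subalgebra.smul_mem _ (pow_mem coordD_mem _) _,
        fun x => ?_, ?_⟩
      · rw [map_smul, ContinuousMap.smul_apply, hpow, smul_eq_mul, fourier_neg, ← Complex.conj_re]
        simp
      · rw [ContinuousMap.smul_apply, hzero k (by simpa using hn)]; simp
  | zero => exact fun c => ⟨0, zero_mem _, by simp, by simp⟩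
  | add s t _ _ hs ht =>
    intro c
    obtain ⟨P, hP, h1, h2⟩ := hs c
    obtain ⟨Q, hQ, h3, h4⟩ := ht c
    refine ⟨P + Q, add_mem hP hQ, fun x => ?_, by simp [h2, h4]⟩
    rw [map_add, ContinuousMap.add_apply, Complex.add_re, h1, h3, ← Complex.add_re, ← mul_add,
      ContinuousMap.add_apply]
  | smul a t _ ht =>
    intro c
    obtain ⟨P, hP, h1, h2⟩ := ht (c * a)
    refine ⟨P, hP, fun x => ?_, h2⟩
    rw [h1, ContinuousMap.smul_apply, smul_eq_mul, mul_assoc]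

lemma exists_discAlg_re_near {c : Torus → ℝ} (hc : Continuous c) (hc0 : ∀ x, 0 ≤ c x) {ε : ℝ}
    (hε : 0 < ε) : ∃ P ∈ discAlg, (∀ x, 0 ≤ (res P x).re) ∧ (P ⟨0, by simp⟩).im = 0 ∧
      ∀ x, |(res P x).re - c x| ≤ ε := by
  let C : C(Torus, ℂ) := ⟨fun x => (c x : ℂ), by fun_prop⟩
  have hC : C ∈ closure (Submodule.span ℂ (range (fourier : ℤ → C(Torus, ℂ))) : Set _) := by
    rw [← Submodule.topologicalClosure_coe, span_fourier_closure_eq_top]; trivial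
  obtain ⟨t, ht, htC⟩ := Metric.mem_closure_iff.1 hC (ε / 2) (by positivity)
  obtain ⟨P, hP, h1, h2⟩ := exists_discAlg_re_eq ht
  have h3 : ∀ x, |(t x).re - c x| ≤ ε / 2 := fun x => by
    have h4 : dist (C x) (t x) ≤ ε / 2 := (ContinuousMap.dist_apply_le_dist x).trans htC.le
    rw [dist_comm, dist_eq_norm] at h4
    refine le_trans ?_ ((Complex.abs_re_le_norm _).trans h4)
    simp [C]
  refine ⟨P + algebraMap ℂ _ ((ε / 2 : ℝ) : ℂ),
    discSub.add_mem hP (discSub.algebraMap_mem _), fun x => ?_, ?_, fun x => ?_⟩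
  · have := abs_le.1 (h3 x)
    rw [map_add, ContinuousMap.add_apply, Complex.add_re, h1, AlgHom.commutes]
    simp
    linarith [hc0 x]
  · simp [h2]
  · have := abs_le.1 (h3 x)
    rw [map_add, ContinuousMap.add_apply, Complex.add_re, h1, AlgHom.commutes]
    simp
    rw [abs_le]; constructor <;> linarith

/-- Square integrable nonnegative functions are limits of real parts of functions in the disc
algebra. -/
lemma exists_seq_discAlg_re_tendsto (ν : Measure Torus) [IsFiniteMeasure ν] {v : Torus → ℝ}
    (hv : MemLp v 2 ν) (hv0 : ∀ x, 0 ≤ v x) :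
    ∃ P : ℕ → C(CD, ℂ), (∀ j, P j ∈ discAlg) ∧ (∀ j x, 0 ≤ (res (P j) x).re) ∧
      (∀ j, (P j ⟨0, by simp⟩).im = 0) ∧
      (∀ᵐ x ∂ν, Tendsto (fun j => (res (P j) x).re) atTop (𝓝 (v x))) ∧
      Tendsto (fun j => eLpNorm (fun x => (res (P j) x).re - v x) 2 ν) atTop (𝓝 0) := by
  have step : ∀ δ : ENNReal, δ ≠ 0 → ∃ P ∈ discAlg, (∀ x, 0 ≤ (res P x).re) ∧
      (P ⟨0, by simp⟩).im = 0 ∧ eLpNorm (fun x => (res P x).re - v x) 2 ν ≤ δ := by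
    intro δ hδ
    have hδ2 : δ / 2 ≠ 0 := by simpa using hδ
    obtain ⟨g, hg, hgm⟩ := hv.exists_boundedContinuous_eLpNorm_sub_le (by simp) hδ2
    have hmax : Continuous fun x => max (g x) 0 := by fun_prop
    obtain ⟨ε, hε, hεδ⟩ : ∃ ε : ℝ, 0 < ε ∧
        eLpNorm (fun _ : Torus => ε) 2 ν ≤ δ / 2 := by
      have h1 : Tendsto (fun ε : ℝ => eLpNorm (fun _ : Torus => ε) 2 ν) (𝓝[>] 0) (𝓝 0) := by
        have h2 : ∀ ε : ℝ, eLpNorm (fun _ : Torus => ε) 2 ν =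
            ‖ε‖ₑ * ν univ ^ (1 / (2 : ENNReal).toReal) := fun ε =>
          eLpNorm_const' ε (by simp) (by simp)
        simp_rw [h2]
        have h3 : Tendsto (fun ε : ℝ => ‖ε‖ₑ) (𝓝[>] 0) (𝓝 0) := by
          have : Tendsto (fun ε : ℝ => ‖ε‖ₑ) (𝓝 0) (𝓝 ‖(0 : ℝ)‖ₑ) := continuous_enorm.tendsto 0
          simpa using this.mono_left nhdsWithin_le_nhds
        have := ENNReal.Tendsto.mul_const (b := ν univ ^ (1 / (2 : ENNReal).toReal)) h3
          (Or.inr (by finiteness))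
        simpa using this
      have h2 := h1.eventually (eventually_le_nhds (pos_iff_ne_zero.2 hδ2))
      obtain ⟨ε, h3, h4⟩ := (h2.and self_mem_nhdsWithin).exists
      exact ⟨ε, h4, h3⟩
    obtain ⟨P, hP, h1, h2, h3⟩ := exists_discAlg_re_near hmax (fun x => le_max_right _ _) hε
    refine ⟨P, hP, h1, h2, ?_⟩
    have hmeas : AEStronglyMeasurable (fun x => (res P x).re - max (g x) 0) ν :=
      Continuous.aestronglyMeasurable (by fun_prop)
    have hmeas2 : AEStronglyMeasurable (fun x => max (g x) 0 - v x) ν :=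
      hmax.aestronglyMeasurable.sub hv.1
    have h4 : (fun x => (res P x).re - v x) =
        (fun x => (res P x).re - max (g x) 0) + fun x => max (g x) 0 - v x := by
      ext x; simp
    rw [h4, ← ENNReal.add_halves δ]
    refine (eLpNorm_add_le hmeas hmeas2 (by norm_num)).trans (add_le_add ?_ ?_)
    · refine (eLpNorm_mono_real fun x => ?_).trans hεδ
      exact h3 x
    · refine (eLpNorm_mono (g := fun x => v x - g x) fun x => ?_).trans hg
      simp only [Real.norm_eq_abs]
      rw [abs_sub_comm (v x)]
      have := abs_max_sub_max_le_abs (g x) (v x) 0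
      rwa [max_eq_left (hv0 x)] at this
  choose P hP h1 h2 h3 using fun j : ℕ => step (((j : ENNReal) + 1)⁻¹) (by simp)
  have htend : Tendsto (fun j => eLpNorm (fun x => (res (P j) x).re - v x) 2 ν) atTop (𝓝 0) := by
    refine tendsto_of_tendsto_of_tendsto_of_le_of_le tendsto_const_nhds ?_
      (fun _ => zero_le) h3
    have := (tendsto_add_atTop_iff_nat 1).2 ENNReal.tendsto_inv_nat_nhds_zero
    simpa using this
  have hmeas : TendstoInMeasure ν (fun j x => (res (P j) x).re) atTop v :=
    tendstoInMeasure_of_tendsto_eLpNorm (p := 2) (by simp)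
      (fun j => Continuous.aestronglyMeasurable (by fun_prop)) hv.1 htend
  obtain ⟨φ, hφ, hae⟩ := hmeas.exists_seq_tendsto_ae
  exact ⟨P ∘ φ, fun j => hP _, fun j => h1 _, fun j => h2 _, hae, htend.comp hφ.tendsto_atTop⟩

lemma exp_neg_smul_mem {P : C(CD, ℂ)} (hP : P ∈ discAlg) (t : ℝ) :
    NormedSpace.exp (-(t : ℂ) • P) ∈ discAlg :=
  exp_mem_discAlg (Subalgebra.smul_mem discSub hP _)

lemma res_exp_neg_smul (P : C(CD, ℂ)) (t : ℝ) (x : Torus) :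
    res (NormedSpace.exp (-(t : ℂ) • P)) x = Complex.exp (-t * res P x) := by
  rw [res_apply, exp_continuousMap_apply, ContinuousMap.smul_apply, smul_eq_mul, res_apply]

lemma norm_res_exp_neg_smul (P : C(CD, ℂ)) (t : ℝ) (x : Torus) :
    ‖res (NormedSpace.exp (-(t : ℂ) • P)) x‖ = Real.exp (-t * (res P x).re) := by
  rw [res_exp_neg_smul, Complex.norm_exp, ← Complex.ofReal_neg, Complex.re_ofReal_mul]

lemma exp_neg_smul_zero {P : C(CD, ℂ)} (h0 : (P ⟨0, by simp⟩).im = 0) (t : ℝ) :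
    NormedSpace.exp (-(t : ℂ) • P) ⟨0, by simp⟩ =
      (Real.exp (-t * (P ⟨0, by simp⟩).re) : ℝ) := by
  rw [exp_continuousMap_apply, ContinuousMap.smul_apply, smul_eq_mul]
  have : P ⟨0, by simp⟩ = ((P ⟨0, by simp⟩).re : ℂ) := Complex.ext rfl (by simpa using h0)
  rw [this]
  push_cast
  simp

lemma integral_re_res {P : C(CD, ℂ)} (hP : P ∈ discAlg) :
    ∫ x, (res P x).re ∂arcM = (P ⟨0, by simp⟩).re := by
  rw [← integral_res P hP]
  exact integral_re (integrable_continuous _)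

lemma tendsto_re_zero_of_eLpNorm {P : ℕ → C(CD, ℂ)} (hP : ∀ j, P j ∈ discAlg) {v : Torus → ℝ}
    (hv : MemLp v 2 arcM)
    (h : Tendsto (fun j => eLpNorm (fun x => (res (P j) x).re - v x) 2 arcM) atTop (𝓝 0)) :
    Tendsto (fun j => (P j ⟨0, by simp⟩).re) atTop (𝓝 (∫ x, v x ∂arcM)) := by
  simp_rw [← integral_re_res (hP _)]
  have hcont : ∀ j, Continuous fun x => (res (P j) x).re := fun j => by fun_prop
  refine tendsto_integral_of_L1' v hv.1
    (Eventually.of_forall fun j => (integrable_continuous _).re) ?_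
  refine tendsto_of_tendsto_of_tendsto_of_le_of_le tendsto_const_nhds h (fun _ => zero_le)
    fun j => ?_
  refine eLpNorm_le_eLpNorm_of_exponent_le (by norm_num) ?_
  exact (hcont j).aestronglyMeasurable.sub hv.1

lemma AnalyticOnCircle.integral_res_mul {G : Torus → ℂ} (hG : AnalyticOnCircle G)
    {a : C(CD, ℂ)} (ha : a ∈ discAlg) :
    ∫ x, res a x * G x ∂arcM = a ⟨0, by simp⟩ * ∫ x, G x ∂arcM := by
  have := cext_res_mul hG (w := 0) (by simp) a ha
  simpa [cext, cker] using this

lemma AnalyticOnCircle.exp_mul_norm_integral_le {G : Torus → ℂ} (hG : AnalyticOnCircle G)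
    {E : Set Torus} (hE : MeasurableSet E) (hGE : ∀ x ∈ E, G x = 0) {t : ℝ} (ht : 0 ≤ t) :
    Real.exp (-t * arcM.real Eᶜ) * ‖∫ x, G x ∂arcM‖ ≤ Real.exp (-t) * ∫ x, ‖G x‖ ∂arcM := by
  have hv : MemLp (Eᶜ.indicator fun _ => (1 : ℝ)) 2 arcM :=
    memLp_indicator_const 2 hE.compl 1 (Or.inr (by finiteness))
  obtain ⟨P, hP, h1, h2, h3, h4⟩ := exists_seq_discAlg_re_tendsto arcM hv
    (fun x => indicator_nonneg (fun _ _ => zero_le_one) x)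
  have h5 := tendsto_re_zero_of_eLpNorm hP hv h4
  rw [integral_indicator_const _ hE.compl, smul_eq_mul, mul_one] at h5
  have hj : ∀ j, Real.exp (-t * (P j ⟨0, by simp⟩).re) * ‖∫ x, G x ∂arcM‖ ≤
      ∫ x, Real.exp (-t * (res (P j) x).re) * ‖G x‖ ∂arcM := by
    intro j
    have h6 := congrArg norm (hG.integral_res_mul (exp_neg_smul_mem (hP j) t))
    rw [exp_neg_smul_zero (h2 j), norm_mul, Complex.norm_real,
      Real.norm_of_nonneg (Real.exp_pos _).le] at h6
    rw [← h6]
    refine (norm_integral_le_integral_norm _).trans_eq ?_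
    simp_rw [norm_mul, norm_res_exp_neg_smul]
  have hlim : Tendsto (fun j => ∫ x, Real.exp (-t * (res (P j) x).re) * ‖G x‖ ∂arcM) atTop
      (𝓝 (∫ x, Real.exp (-t) * ‖G x‖ ∂arcM)) := by
    refine tendsto_integral_of_dominated_convergence (fun x => ‖G x‖)
      (fun j => ?_) hG.integrable.norm (fun j => Eventually.of_forall fun x => ?_) ?_
    · exact (Continuous.aestronglyMeasurable (by fun_prop)).mul hG.integrable.1.norm
    · rw [norm_mul, norm_norm, Real.norm_of_nonneg (Real.exp_pos _).le]
      refine mul_le_of_le_one_left (norm_nonneg _) (Real.exp_le_one_iff.2 ?_)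
      have := mul_nonneg ht (h1 j x)
      linarith
    · filter_upwards [h3] with x hx
      by_cases hxE : x ∈ E
      · simp [hGE x hxE]
      · rw [indicator_of_mem (show x ∈ Eᶜ from hxE)] at hx
        have := (Real.continuous_exp.tendsto _).comp (hx.const_mul (-t : ℝ))
        rw [mul_one] at this
        exact this.mul_const _
  have hlim2 := ((Real.continuous_exp.tendsto _).comp (h5.const_mul (-t : ℝ))).mul_const
    ‖∫ x, G x ∂arcM‖
  have h7 := le_of_tendsto_of_tendsto' hlim2 hlim hj
  rwa [integral_const_mul] at h7

/-- Uniqueness: a function analytic on the circle with nonzero mean vanishes only on null sets. -/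
lemma AnalyticOnCircle.measure_eq_zero {G : Torus → ℂ} (hG : AnalyticOnCircle G)
    (h0 : ∫ x, G x ∂arcM ≠ 0) {E : Set Torus} (hE : MeasurableSet E)
    (hGE : ∀ x ∈ E, G x = 0) : arcM E = 0 := by
  by_contra hne
  have hlt : arcM.real Eᶜ < 1 := by
    rw [probReal_compl_eq_one_sub hE]
    have : 0 < arcM.real E := ENNReal.toReal_pos hne (by finiteness)
    linarith
  have hpos : 0 < ‖∫ x, G x ∂arcM‖ := norm_pos_iff.2 h0
  have htop : Tendsto (fun t : ℝ => Real.exp (t * (1 - arcM.real Eᶜ)) * ‖∫ x, G x ∂arcM‖) atTop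
      atTop := by
    refine Tendsto.atTop_mul_const hpos (Real.tendsto_exp_atTop.comp ?_)
    exact tendsto_id.atTop_mul_const (by linarith)
  obtain ⟨t, ht, ht0⟩ :=
    ((htop.eventually_gt_atTop (∫ x, ‖G x‖ ∂arcM)).and (eventually_ge_atTop 0)).exists
  refine absurd ?_ (not_le.2 ht)
  have h8 := mul_le_mul_of_nonneg_left (hG.exp_mul_norm_integral_le hE hGE ht0) (Real.exp_pos t).le
  rw [← mul_assoc, ← mul_assoc, ← Real.exp_add, ← Real.exp_add, neg_mul, add_neg_cancel,
    Real.exp_zero, one_mul] at h8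
  rwa [mul_sub, mul_one, sub_eq_add_neg]

/-- Bounded functions in the disc algebra that tend to `0` on a prescribed null set of the circle
and to `1` almost everywhere for arc length. -/
lemma exists_seq_discAlg_peak (μ : Measure Torus) [IsFiniteMeasure μ] {S : Set Torus}
    (hS : MeasurableSet S) (hS0 : arcM S = 0) :
    ∃ e : ℕ → C(CD, ℂ), (∀ j, e j ∈ discAlg) ∧ (∀ j x, ‖res (e j) x‖ ≤ 1) ∧
      Tendsto (fun j => e j ⟨0, by simp⟩) atTop (𝓝 1) ∧
      (∀ᵐ x ∂arcM, Tendsto (fun j => res (e j) x) atTop (𝓝 1)) ∧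
      ∀ᵐ x ∂μ, x ∈ S → Tendsto (fun j => res (e j) x) atTop (𝓝 0) := by
  have hv : MemLp (S.indicator fun _ => (1 : ℝ)) 2 (arcM + μ) :=
    memLp_indicator_const 2 hS 1 (Or.inr (by finiteness))
  obtain ⟨P, hP, h1, h2, h3, h4⟩ := exists_seq_discAlg_re_tendsto (arcM + μ) hv
    (fun x => indicator_nonneg (fun _ _ => zero_le_one) x)
  have hle : (arcM : Measure Torus) ≤ arcM + μ := Measure.le_add_right le_rfl
  have h5 := tendsto_re_zero_of_eLpNorm hP (hv.mono_measure hle)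
    (tendsto_of_tendsto_of_tendsto_of_le_of_le tendsto_const_nhds h4 (fun _ => zero_le)
      fun j => eLpNorm_mono_measure _ hle)
  rw [integral_indicator_const _ hS, Measure.real, hS0, ENNReal.toReal_zero, zero_smul] at h5
  obtain ⟨φ, hφ, hφ'⟩ := extraction_forall_of_eventually' (P := fun n j =>
    2 ^ n * (P j ⟨0, by simp⟩).re ≤ 1 / ((n : ℝ) + 1)) (fun n => by
      have : Tendsto (fun j => (2 : ℝ) ^ n * (P j ⟨0, by simp⟩).re) atTop (𝓝 0) := by
        simpa using h5.const_mul ((2 : ℝ) ^ n)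
      exact this.eventually (eventually_le_nhds (by positivity)) |>.exists_forall_of_atTop)
  have hP0 : ∀ j, 0 ≤ (P j ⟨0, by simp⟩).re := fun j => by
    rw [← integral_re_res (hP j)]; exact integral_nonneg (h1 j)
  set e : ℕ → C(CD, ℂ) := fun n => NormedSpace.exp (-((2 ^ n : ℝ) : ℂ) • P (φ n)) with he
  have hemem : ∀ j, e j ∈ discAlg := fun j => exp_neg_smul_mem (hP _) _
  have hele : ∀ j x, ‖res (e j) x‖ ≤ 1 := fun j x => by
    rw [he, norm_res_exp_neg_smul, Real.exp_le_one_iff]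
    have := mul_nonneg (by positivity : (0 : ℝ) ≤ 2 ^ j) (h1 (φ j) x)
    linarith
  have hezero : Tendsto (fun j => e j ⟨0, by simp⟩) atTop (𝓝 1) := by
    have h6 : Tendsto (fun n => -2 ^ n * (P (φ n) ⟨0, by simp⟩).re) atTop (𝓝 0) := by
      have : Tendsto (fun n => 2 ^ n * (P (φ n) ⟨0, by simp⟩).re) atTop (𝓝 0) :=
        tendsto_of_tendsto_of_tendsto_of_le_of_le tendsto_const_nhds
          tendsto_one_div_add_atTop_nhds_zero_nat
          (fun n => mul_nonneg (by positivity) (hP0 _)) hφ'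
      simpa using this.neg
    have h7 := (Complex.continuous_ofReal.tendsto _).comp
      ((Real.continuous_exp.tendsto _).comp h6)
    simp only [Real.exp_zero, Complex.ofReal_one] at h7
    refine h7.congr fun n => ?_
    rw [he]
    simp only [exp_neg_smul_zero (h2 (φ n)), Function.comp]
  have hL2 : Tendsto (fun j => eLpNorm (fun x => res (e j) x - (1 : Torus → ℂ) x) 2 arcM)
      atTop (𝓝 0) := by
    have hle_int : ∀ j, ∫ x, ‖res (e j) x - 1‖ ^ 2 ∂arcM ≤ 2 - 2 * (e j ⟨0, by simp⟩).re := by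
      intro j
      calc ∫ x, ‖res (e j) x - 1‖ ^ 2 ∂arcM ≤ ∫ x, (2 - 2 * (res (e j) x).re) ∂arcM := by
            refine integral_mono_of_nonneg (Eventually.of_forall fun x => by positivity) ?_
              (Eventually.of_forall fun x => ?_)
            · exact (integrable_const _).sub ((integrable_continuous _).re.const_mul _)
            · have h8 := hele j x
              have h9 : ‖res (e j) x‖ ^ 2 ≤ 1 := by nlinarith [norm_nonneg (res (e j) x)]
              rw [← Complex.normSq_eq_norm_sq, Complex.normSq_apply] at h9
              beta_reduce
              rw [← Complex.normSq_eq_norm_sq, Complex.normSq_apply]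
              simp only [Complex.sub_re, Complex.sub_im, Complex.one_re, Complex.one_im]
              nlinarith
        _ = _ := by
            have hi : Integrable (fun x => 2 * (res (e j) x).re) arcM :=
              (integrable_continuous _).re.const_mul _
            rw [integral_sub (integrable_const _) hi, integral_const_mul,
              integral_re_res (hemem j)]
            simp
    have hint0 : Tendsto (fun j => ∫ x, ‖res (e j) x - 1‖ ^ 2 ∂arcM) atTop (𝓝 0) := by
      refine tendsto_of_tendsto_of_tendsto_of_le_of_le tendsto_const_nhds ?_
        (fun n => integral_nonneg fun x => by positivity) hle_int
      have := ((Complex.continuous_re.tendsto _).comp hezero).const_mul 2 |>.const_sub 2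
      simpa using this
    have hmem : ∀ j, MemLp (fun x => res (e j) x - (1 : Torus → ℂ) x) 2 arcM := fun j =>
      ((res (e j) - 1).continuous.memLp_of_hasCompactSupport (HasCompactSupport.of_compactSpace _))
    simp_rw [(hmem _).eLpNorm_eq_integral_rpow_norm (by norm_num) (by norm_num)]
    have h10 := (ENNReal.continuous_ofReal.tendsto _).comp
      (hint0.rpow_const (p := 2⁻¹) (Or.inr (by norm_num)))
    simpa [Function.comp_def] using h10
  have hmeas := tendstoInMeasure_of_tendsto_eLpNorm (p := 2) (by simp)
      (fun j => Continuous.aestronglyMeasurable (by fun_prop)) aestronglyMeasurable_const hL2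
  obtain ⟨ψ, hψ, hae⟩ := hmeas.exists_seq_tendsto_ae
  refine ⟨e ∘ ψ, fun j => hemem _, fun j => hele _, hezero.comp hψ.tendsto_atTop, hae, ?_⟩
  have h3' : ∀ᵐ x ∂μ, Tendsto (fun j => (res (P j) x).re) atTop
      (𝓝 (S.indicator (fun _ => (1 : ℝ)) x)) :=
    (Measure.absolutelyContinuous_of_le (Measure.le_add_left le_rfl)) h3
  filter_upwards [h3'] with x hx hxS
  rw [indicator_of_mem hxS] at hx
  suffices h : Tendsto (fun j => res (e j) x) atTop (𝓝 0) from h.comp hψ.tendsto_atTop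
  rw [tendsto_zero_iff_norm_tendsto_zero]
  simp_rw [he, norm_res_exp_neg_smul]
  refine Real.tendsto_exp_atBot.comp ?_
  simp_rw [neg_mul]
  refine tendsto_neg_atTop_atBot.comp ?_
  exact (tendsto_pow_atTop_atTop_of_one_lt one_lt_two).atTop_mul_pos one_pos
    (hx.comp hφ.tendsto_atTop)

lemma memLp_continuous {E : Type*} [NormedAddCommGroup E] {μ : Measure Torus} [IsFiniteMeasure μ]
    {f : Torus → E} (hf : Continuous f) : MemLp f 2 μ :=
  hf.memLp_of_hasCompactSupport (HasCompactSupport.of_compactSpace _)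

lemma integral_norm_sq_res_le {P : C(CD, ℂ)} (hP : P ∈ discAlg) (h0 : (P ⟨0, by simp⟩).im = 0) :
    ∫ x, ‖res P x‖ ^ 2 ∂arcM ≤ 2 * ∫ x, ‖(res P x).re‖ ^ 2 ∂arcM := by
  have h1 := integral_re_res (discSub.mul_mem hP hP)
  rw [ContinuousMap.mul_apply, Complex.mul_re, h0, mul_zero, sub_zero] at h1
  have hcont : ∀ {f : Torus → ℝ}, Continuous f → Integrable f arcM := fun hf =>
    hf.integrable_of_hasCompactSupport (HasCompactSupport.of_compactSpace _)
  rw [← sub_nonneg, ← integral_const_mul,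
    ← integral_sub (hcont (by fun_prop)) (hcont (by fun_prop))]
  have h2 : (fun x => 2 * ‖(res P x).re‖ ^ 2 - ‖res P x‖ ^ 2) = fun x => (res (P * P) x).re := by
    ext x
    rw [map_mul, ContinuousMap.mul_apply, Complex.mul_re, ← Complex.normSq_eq_norm_sq,
      Complex.normSq_apply, Real.norm_eq_abs, sq_abs]
    ring
  rw [h2, h1]
  exact mul_self_nonneg _

lemma eLpNorm_res_le {P : C(CD, ℂ)} (hP : P ∈ discAlg) (h0 : (P ⟨0, by simp⟩).im = 0) :
    eLpNorm (res P) 2 arcM ≤ 2 * eLpNorm (fun x => (res P x).re) 2 arcM := by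
  have h1 : MemLp (res P) 2 arcM := memLp_continuous (res P).continuous
  have h2 : MemLp (fun x => (res P x).re) 2 arcM := memLp_continuous (by fun_prop)
  rw [h1.eLpNorm_eq_integral_rpow_norm (by norm_num) (by norm_num),
    h2.eLpNorm_eq_integral_rpow_norm (by norm_num) (by norm_num)]
  rw [← ENNReal.ofReal_ofNat 2, ← ENNReal.ofReal_mul (by norm_num)]
  refine ENNReal.ofReal_le_ofReal ?_
  simp only [ENNReal.ofReal_ofNat, ENNReal.toReal_ofNat, Real.rpow_ofNat, ← one_div, ← Real.sqrt_eq_rpow]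
  have h4 := integral_norm_sq_res_le hP h0
  have h5 : 0 ≤ ∫ x, ‖(res P x).re‖ ^ 2 ∂arcM := integral_nonneg fun x => by positivity
  refine (Real.sqrt_le_sqrt h4).trans ?_
  rw [Real.sqrt_le_iff]
  refine ⟨by positivity, ?_⟩
  rw [mul_pow, Real.sq_sqrt h5]
  linarith

/-- A nonnegative square integrable function is the real part of an `L²` limit of the disc
algebra. -/
lemma exists_analytic_completion {v : Torus → ℝ} (hv : MemLp v 2 arcM) (hv0 : ∀ x, 0 ≤ v x) :
    ∃ (P : ℕ → C(CD, ℂ)) (F : Torus → ℂ), (∀ j, P j ∈ discAlg) ∧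
      (∀ j x, 0 ≤ (res (P j) x).re) ∧ AEStronglyMeasurable F arcM ∧
      (∀ᵐ x ∂arcM, Tendsto (fun j => res (P j) x) atTop (𝓝 (F x))) ∧
      ∀ᵐ x ∂arcM, (F x).re = v x := by
  obtain ⟨P, hP, h1, h2, h3, h4⟩ := exists_seq_discAlg_re_tendsto arcM hv hv0
  have hmem : ∀ j, MemLp (res (P j)) 2 arcM := fun j => memLp_continuous (res (P j)).continuous
  have hcauchy : CauchySeq fun j => (hmem j).toLp _ := by
    rw [EMetric.cauchySeq_iff]
    intro ε hε
    have hε4 : 0 < ε / 8 := ENNReal.div_pos hε.ne' (by simp)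
    obtain ⟨N, hN⟩ := eventually_atTop.1 (h4.eventually (eventually_le_nhds hε4))
    by_cases hεtop : ε = ⊤
    · exact ⟨0, fun m _ n _ => by rw [hεtop]; exact edist_lt_top _ _⟩
    refine ⟨N, fun m hm n hn => ?_⟩
    rw [Lp.edist_toLp_toLp]
    have hmem' : P m - P n ∈ discAlg := discSub.sub_mem (hP m) (hP n)
    have h5 := eLpNorm_res_le hmem' (by simp [h2])
    have h6 : (⇑(res (P m)) - ⇑(res (P n))) = res (P m - P n) := by
      rw [map_sub, ContinuousMap.coe_sub]
    rw [h6]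
    have h7 : (fun x => (res (P m - P n) x).re) =
        (fun x => (res (P m) x).re - v x) - fun x => (res (P n) x).re - v x := by
      ext x; simp
    have h8 : ∀ j, AEStronglyMeasurable (fun x => (res (P j) x).re - v x) arcM := fun j =>
      (Continuous.aestronglyMeasurable (by fun_prop)).sub hv.1
    calc _ ≤ 2 * (ε / 8 + ε / 8) := h5.trans (by
            gcongr
            rw [h7]
            exact (eLpNorm_sub_le (h8 m) (h8 n) (by norm_num)).trans
              (add_le_add (hN m hm) (hN n hn)))
      _ = ε / 2 := by
            rw [← two_mul, ← mul_assoc, div_eq_mul_inv, div_eq_mul_inv, mul_left_comm]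
            congr 1
            rw [show (8 : ENNReal) = 2 * 2 * 2 by norm_num, ENNReal.mul_inv (by simp) (by simp),
              ← mul_assoc, ENNReal.mul_inv_cancel (by norm_num) (by finiteness), one_mul]
      _ < ε := ENNReal.half_lt_self hε.ne' hεtop
  obtain ⟨F, hF⟩ := cauchySeq_tendsto_of_complete hcauchy
  obtain ⟨φ, hφ, hae⟩ := (tendstoInMeasure_of_tendsto_Lp hF).exists_seq_tendsto_ae
  have hae' : ∀ᵐ x ∂arcM, Tendsto (fun j => res (P (φ j)) x) atTop (𝓝 (F x)) := by
    have : ∀ᵐ x ∂arcM, ∀ j, (hmem j).toLp _ x = res (P j) x :=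
      ae_all_iff.2 fun j => (hmem j).coeFn_toLp
    filter_upwards [hae, this] with x hx hx'
    simpa only [hx'] using hx
  refine ⟨P ∘ φ, F, fun j => hP _, fun j => h1 _, Lp.aestronglyMeasurable F, hae', ?_⟩
  filter_upwards [hae', h3] with x hx hx'
  exact tendsto_nhds_unique ((Complex.continuous_re.tendsto _).comp hx)
    (hx'.comp hφ.tendsto_atTop)

/-- A sequence of radii increasing to `1`. -/
def rad (n : ℕ) : ℝ := (n + 1) / (n + 2)

lemma rad_pos (n : ℕ) : 0 < rad n := by unfold rad; positivity

lemma rad_lt_one (n : ℕ) : rad n < 1 := by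
  unfold rad; rw [div_lt_one (by positivity)]; linarith

lemma tendsto_rad : Tendsto rad atTop (𝓝 1) := by
  have h := (tendsto_one_div_add_atTop_nhds_zero_nat (𝕜 := ℝ)).comp (tendsto_add_atTop_nat 1)
  have h2 := h.const_sub 1
  rw [sub_zero] at h2
  refine h2.congr fun n => ?_
  simp only [Function.comp, rad]
  push_cast
  field_simp
  ring

lemma norm_rad_mul_lt {n : ℕ} {z : ℂ} (hz : ‖z‖ ≤ 1) : ‖(rad n : ℂ) * z‖ < 1 := by
  rw [norm_mul, Complex.norm_real, Real.norm_of_nonneg (rad_pos n).le]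
  nlinarith [rad_pos n, rad_lt_one n, norm_nonneg z]

/-- The contraction of the closed disc by the factor `rad n`. -/
def dil (n : ℕ) : C(CD, CD) :=
  ⟨fun z => ⟨rad n * z, mem_closedBall_zero_iff.2
    (norm_rad_mul_lt (mem_closedBall_zero_iff.1 z.2)).le⟩, by fun_prop⟩

/-- The dilation `f ↦ f (rad n * ·)`. -/
def dilate (n : ℕ) : C(CD, ℂ) →ₐ[ℂ] C(CD, ℂ) := ContinuousMap.compRightAlgHom ℂ ℂ (dil n)

lemma continuous_dilate (n : ℕ) : Continuous (dilate n) :=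
  ContinuousMap.compRightAlgHom_continuous _ _ _

lemma dilate_coordD (n : ℕ) : dilate n coordD = (rad n : ℂ) • coordD := rfl

lemma dilate_mem (n : ℕ) : ∀ a ∈ discAlg, dilate n a ∈ discAlg := by
  refine discAlg_induction (isClosed_discSub.preimage (continuous_dilate n)) ?_ ?_ ?_ ?_
  · rw [map_one]; exact discSub.one_mem
  · intro f _ hf
    rw [map_mul, dilate_coordD]
    exact discSub.mul_mem (discSub.smul_mem coordD_mem _) hf
  · intro f g hf hg
    rw [map_add]; exact discSub.add_mem hf hg
  · intro c f hf
    rw [map_smul]; exact discSub.smul_mem hf c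

lemma tendsto_dil : Tendsto dil atTop (𝓝 (ContinuousMap.id CD)) := by
  rw [tendsto_iff_dist_tendsto_zero]
  refine squeeze_zero (fun _ => dist_nonneg) (fun n => ?_)
    (by simpa using tendsto_rad.const_sub 1 : Tendsto (fun n => 1 - rad n) atTop (𝓝 0))
  rw [ContinuousMap.dist_le (by linarith [rad_lt_one n])]
  intro z
  have hz : ‖(z : ℂ)‖ ≤ 1 := mem_closedBall_zero_iff.1 z.2
  rw [dist_comm, Subtype.dist_eq, dist_eq_norm]
  have : ((ContinuousMap.id CD z : CD) : ℂ) - (dil n z : CD) = ((1 - rad n : ℝ) : ℂ) * z := by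
    simp [dil]; ring
  rw [this, norm_mul, Complex.norm_real, Real.norm_of_nonneg (by linarith [rad_lt_one n])]
  exact mul_le_of_le_one_right (by linarith [rad_lt_one n]) hz

lemma tendsto_dilate (a : C(CD, ℂ)) : Tendsto (fun n => dilate n a) atTop (𝓝 a) :=
  ((ContinuousMap.continuous_postcomp a).tendsto _).comp tendsto_dil

lemma fourier_neg_succ_mul_res (k : ℕ) (f : C(CD, ℂ)) :
    fourier (-(k + 1 : ℕ) : ℤ) * res (coordD * f) = fourier (-k : ℤ) * res f := by
  ext x
  rw [map_mul, res_coordD]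
  simp only [ContinuousMap.mul_apply]
  rw [← mul_assoc, ← fourier_add]
  congr 3
  push_cast; ring

lemma integral_fourier_mul_res_dilate (n : ℕ) : ∀ a ∈ discAlg, ∀ k : ℕ,
    ∫ x, (fourier (-k : ℤ) * res (dilate n a) : C(Torus, ℂ)) x ∂arcM =
      rad n ^ k * ∫ x, (fourier (-k : ℤ) * res a : C(Torus, ℂ)) x ∂arcM := by
  set L := pairing arcM (fun _ => 1) (integrable_const _)
  have hL : ∀ φ : C(Torus, ℂ), ∫ x, φ x ∂arcM = L φ := fun φ => by simp [L, pairing_apply]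
  simp_rw [hL]
  refine discAlg_induction ?_ ?_ ?_ ?_ ?_
  · simp only [Set.ofPred_forall]
    exact isClosed_iInter fun k => isClosed_eq
      (L.continuous.comp (continuous_const.mul (continuous_res.comp (continuous_dilate n))))
      (continuous_const.mul (L.continuous.comp (continuous_const.mul continuous_res)))
  · intro k
    rcases k with - | k
    · simp
    · have h0 : L (fourier (-(k + 1 : ℕ) : ℤ)) = 0 := by
        rw [← hL]; exact integral_fourier_of_ne (by push_cast; omega)
      simp only [map_one, mul_one, h0, mul_zero]
  · intro f hf ih k
    rcases k with - | k
    · have h0 : ∀ b ∈ discAlg, L (fourier (-(0 : ℕ) : ℤ) * res (coordD * b)) = 0 := by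
        intro b hb
        rw [← hL]
        have := integral_res _ (discSub.mul_mem coordD_mem hb)
        simpa [coordD] using this
      rw [map_mul (dilate n), dilate_coordD, smul_mul_assoc, map_smul, mul_smul_comm, map_smul,
        h0 f hf, h0 _ (dilate_mem n f hf)]
      simp
    · rw [map_mul (dilate n), dilate_coordD, smul_mul_assoc, map_smul, mul_smul_comm, map_smul,
        fourier_neg_succ_mul_res, fourier_neg_succ_mul_res, ih, smul_eq_mul, pow_succ]
      ring
  · intro f g hf hg k
    rw [map_add, map_add, map_add, mul_add, mul_add, map_add, map_add, hf, hg, mul_add]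
  · intro c f hf k
    rw [map_smul, map_smul, map_smul, mul_smul_comm, mul_smul_comm, map_smul, map_smul, hf]
    simp only [smul_eq_mul]; ring

lemma norm_fourierCoeff_dilate_le (n : ℕ) {a : C(CD, ℂ)} (ha : a ∈ discAlg) (k : ℤ) :
    ‖fourierCoeff (res (dilate n a)) k‖ ≤ ‖fourierCoeff (res a) k‖ := by
  rcases le_or_gt 0 k with hk | hk
  · lift k to ℕ using hk
    have := integral_fourier_mul_res_dilate n a ha k
    simp only [ContinuousMap.mul_apply] at this
    simp only [fourierCoeff, smul_eq_mul]
    rw [this, norm_mul, norm_pow, Complex.norm_real, Real.norm_of_nonneg (rad_pos n).le]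
    exact mul_le_of_le_one_left (norm_nonneg _) (pow_le_one₀ (rad_pos n).le (rad_lt_one n).le)
  · obtain ⟨m, rfl⟩ : ∃ m : ℕ, k = -(m + 1 : ℤ) := ⟨(-k - 1).toNat, by omega⟩
    have := (analyticOnCircle_res (dilate_mem n a ha)).coeff m
    simp only [fourierCoeff, neg_neg, smul_eq_mul]
    rw [this, norm_zero]
    exact norm_nonneg _

lemma norm_toLp_sq (φ : C(Torus, ℂ)) :
    ∑' k : ℤ, ‖fourierCoeff φ k‖ ^ 2 = ∫ x, ‖φ x‖ ^ 2 ∂arcM := by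
  have h := tsum_sq_fourierCoeff (T := 2 * Real.pi) (ContinuousMap.toLp 2 arcM ℂ φ)
  have hae := ContinuousMap.coeFn_toLp (p := 2) (𝕜 := ℂ) (arcM : Measure Torus) φ
  rw [integral_congr_ae (hae.mono fun x hx => by
    show _ = ‖φ x‖ ^ 2; rw [← hx])] at h
  rw [← h]
  congr 1; ext k
  rw [fourierCoeff_congr_ae hae]

lemma summable_norm_fourierCoeff_sq (φ : C(Torus, ℂ)) :
    Summable fun k : ℤ => ‖fourierCoeff φ k‖ ^ 2 := by
  have h := (hasSum_sq_fourierCoeff (T := 2 * Real.pi) (ContinuousMap.toLp 2 arcM ℂ φ)).summable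
  have hae := ContinuousMap.coeFn_toLp (p := 2) (𝕜 := ℂ) (arcM : Measure Torus) φ
  refine h.congr fun k => ?_
  rw [fourierCoeff_congr_ae hae]

lemma eLpNorm_res_dilate_le (n : ℕ) {a : C(CD, ℂ)} (ha : a ∈ discAlg) :
    eLpNorm (res (dilate n a)) 2 arcM ≤ eLpNorm (res a) 2 arcM := by
  have h1 : ∀ b : C(CD, ℂ), MemLp (res b) 2 arcM := fun b => memLp_continuous (res b).continuous
  rw [(h1 _).eLpNorm_eq_integral_rpow_norm (by norm_num) (by norm_num),
    (h1 _).eLpNorm_eq_integral_rpow_norm (by norm_num) (by norm_num)]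
  refine ENNReal.ofReal_le_ofReal ?_
  simp only [ENNReal.toReal_ofNat, Real.rpow_ofNat]
  refine Real.rpow_le_rpow (integral_nonneg fun x => by positivity) ?_ (by norm_num)
  rw [← norm_toLp_sq, ← norm_toLp_sq]
  exact Summable.tsum_le_tsum (fun k => by gcongr; exact norm_fourierCoeff_dilate_le n ha k)
    (summable_norm_fourierCoeff_sq _) (summable_norm_fourierCoeff_sq _)

/-- `F` is a limit in `L²` of the circle of boundary values of functions in `J`. -/
structure L2Lim (J : Set C(CD, ℂ)) (F : Torus → ℂ) : Prop where
  memLp : MemLp F 2 arcM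
  approx : ∀ ε : ENNReal, ε ≠ 0 → ∃ g ∈ J, eLpNorm (fun x => res g x - F x) 2 arcM ≤ ε

lemma tendsto_zero_of_le_inv_nat {u : ℕ → ENNReal}
    (h : ∀ n : ℕ, u n ≤ ((n : ENNReal) + 1)⁻¹) : Tendsto u atTop (𝓝 0) := by
  refine tendsto_of_tendsto_of_tendsto_of_le_of_le tendsto_const_nhds ?_ (fun _ => zero_le) h
  have := (tendsto_add_atTop_iff_nat 1).2 ENNReal.tendsto_inv_nat_nhds_zero
  simpa using this

lemma L2Lim.exists_seq {J : Set C(CD, ℂ)} {F : Torus → ℂ} (hF : L2Lim J F) :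
    ∃ g : ℕ → C(CD, ℂ), (∀ n, g n ∈ J) ∧
      Tendsto (fun n => eLpNorm (fun x => res (g n) x - F x) 2 arcM) atTop (𝓝 0) := by
  choose g hg h using fun n : ℕ => hF.approx (((n : ENNReal) + 1)⁻¹) (by simp)
  exact ⟨g, hg, tendsto_zero_of_le_inv_nat h⟩

lemma memLp_res (g : C(CD, ℂ)) : MemLp (res g) 2 arcM := memLp_continuous (res g).continuous

lemma L2Lim.mono {J J' : Set C(CD, ℂ)} (h : J ⊆ J') {F : Torus → ℂ} (hF : L2Lim J F) :
    L2Lim J' F :=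
  ⟨hF.memLp, fun ε hε => let ⟨g, hg, h'⟩ := hF.approx ε hε; ⟨g, h hg, h'⟩⟩

lemma L2Lim.of_approx {J : Set C(CD, ℂ)} {F : Torus → ℂ} (hF : MemLp F 2 arcM)
    (h : ∀ ε : ENNReal, ε ≠ 0 → ∃ F', L2Lim J F' ∧ eLpNorm (fun x => F' x - F x) 2 arcM ≤ ε) :
    L2Lim J F := by
  refine ⟨hF, fun ε hε => ?_⟩
  have hε2 : ε / 2 ≠ 0 := by simpa using hε
  obtain ⟨F', hF', h1⟩ := h _ hε2
  obtain ⟨g, hg, h2⟩ := hF'.approx _ hε2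
  refine ⟨g, hg, ?_⟩
  have h3 : (fun x => res g x - F x) = (fun x => res g x - F' x) + fun x => F' x - F x := by
    ext x; simp
  rw [h3, ← ENNReal.add_halves ε]
  exact (eLpNorm_add_le ((memLp_res g).1.sub hF'.memLp.1) (hF'.memLp.1.sub hF.1)
    (by norm_num)).trans (add_le_add h2 h1)

lemma eLpNorm_continuous_mul_le (φ : C(Torus, ℂ)) (F : Torus → ℂ) (p : ENNReal) :
    eLpNorm (fun x => φ x * F x) p arcM ≤ ENNReal.ofReal ‖φ‖ * eLpNorm F p arcM := by
  refine eLpNorm_le_mul_eLpNorm_of_ae_le_mul (Eventually.of_forall fun x => ?_) p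
  rw [norm_mul]
  gcongr
  exact φ.norm_coe_le_norm x

lemma memLp_continuous_mul (φ : C(Torus, ℂ)) {F : Torus → ℂ} (hF : MemLp F 2 arcM) :
    MemLp (fun x => φ x * F x) 2 arcM :=
  ⟨φ.continuous.aestronglyMeasurable.mul hF.1,
    (eLpNorm_continuous_mul_le φ F 2).trans_lt (ENNReal.mul_lt_top (by simp) hF.2)⟩

lemma L2Lim.res_mul {J : Set C(CD, ℂ)} (hJ : IsClosedIdealD J) {F : Torus → ℂ} (hF : L2Lim J F)
    {a : C(CD, ℂ)} (ha : a ∈ discAlg) : L2Lim J (fun x => res a x * F x) := by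
  refine ⟨memLp_continuous_mul _ hF.memLp, fun ε hε => ?_⟩
  have hδ : ε / (ENNReal.ofReal ‖res a‖ + 1) ≠ 0 :=
    (ENNReal.div_pos hε (by finiteness)).ne'
  obtain ⟨g, hg, h⟩ := hF.approx _ hδ
  refine ⟨a * g, hJ.mul_mem a ha g hg, ?_⟩
  have h3 : (fun x => res (a * g) x - res a x * F x) = fun x => res a x * (res g x - F x) := by
    ext x; rw [map_mul, ContinuousMap.mul_apply, mul_sub]
  rw [h3]
  refine (eLpNorm_continuous_mul_le _ _ _).trans ?_
  calc _ ≤ (ENNReal.ofReal ‖res a‖ + 1) * (ε / (ENNReal.ofReal ‖res a‖ + 1)) := by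
        gcongr; exact le_self_add
    _ ≤ ε := ENNReal.mul_div_le

lemma tendsto_integral_mul {F : ℕ → Torus → ℂ} {F' G : Torus → ℂ} (hF : ∀ n, MemLp (F n) 2 arcM)
    (hF' : MemLp F' 2 arcM) (hG : MemLp G 2 arcM)
    (h : Tendsto (fun n => eLpNorm (fun x => F n x - F' x) 2 arcM) atTop (𝓝 0)) :
    Tendsto (fun n => ∫ x, F n x * G x ∂arcM) atTop (𝓝 (∫ x, F' x * G x ∂arcM)) := by
  refine tendsto_integral_of_L1' _ (hF'.1.mul hG.1)
    (Eventually.of_forall fun n => (hF n).integrable_mul hG) ?_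
  have h1 : Tendsto (fun n => eLpNorm (fun x => F n x - F' x) 2 arcM * eLpNorm G 2 arcM) atTop
      (𝓝 0) := by
    simpa using ENNReal.Tendsto.mul_const h (Or.inr hG.2.ne)
  refine tendsto_of_tendsto_of_tendsto_of_le_of_le tendsto_const_nhds h1 (fun _ => zero_le)
    fun n => ?_
  have h2 := eLpNorm_smul_le_mul_eLpNorm (p := 2) (q := 2) (r := 1) hG.1 ((hF n).1.sub hF'.1)
  refine le_trans (le_of_eq ?_) h2
  congr 1; ext x
  simp [sub_mul]

lemma L2Lim.tendsto_integral {g : ℕ → C(CD, ℂ)} {F G : Torus → ℂ}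
    (h : Tendsto (fun n => eLpNorm (fun x => res (g n) x - F x) 2 arcM) atTop (𝓝 0))
    (hF : MemLp F 2 arcM) (hG : MemLp G 2 arcM) :
    Tendsto (fun n => ∫ x, res (g n) x * G x ∂arcM) atTop (𝓝 (∫ x, F x * G x ∂arcM)) :=
  tendsto_integral_mul (fun n => memLp_res (g n)) hF hG h

/-- Relations that hold on `J` persist for `L²` limits. -/
lemma L2Lim.integral_eq_zero {J : Set C(CD, ℂ)} {F G : Torus → ℂ} (hF : L2Lim J F)
    (hG : MemLp G 2 arcM) (h : ∀ g ∈ J, ∫ x, res g x * G x ∂arcM = 0) :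
    ∫ x, F x * G x ∂arcM = 0 := by
  obtain ⟨g, hg, hlim⟩ := hF.exists_seq
  refine tendsto_nhds_unique (L2Lim.tendsto_integral hlim hF.memLp hG) ?_
  simp only [h _ (hg _)]
  exact tendsto_const_nhds

lemma L2Lim.analyticOnCircle {J : Set C(CD, ℂ)} (hJ : J ⊆ discAlg) {F : Torus → ℂ}
    (hF : L2Lim J F) : AnalyticOnCircle F where
  integrable := hF.memLp.integrable (by norm_num)
  coeff n := by
    simp_rw [mul_comm _ (F _)]
    refine hF.integral_eq_zero (memLp_continuous (fourier _).continuous) fun g hg => ?_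
    simp_rw [mul_comm (res g _)]
    exact (analyticOnCircle_res (hJ hg)).coeff n

lemma norm_cker_le {w : ℂ} {r : ℝ} (hr : r < 1) (hw : ‖w‖ ≤ r) (x : Torus) :
    ‖cker w x‖ ≤ (1 - r)⁻¹ := by
  have h := congrArg norm (cker_mul (hw.trans_lt hr) x)
  rw [norm_mul, norm_one] at h
  have h1 : 1 - r ≤ ‖1 - w * fourier (-1) x‖ := by
    have h2 := norm_sub_norm_le (1 : ℂ) (w * fourier (-1) x)
    have hfn : ‖(fourier (-1) x : ℂ)‖ = 1 := by rw [fourier_apply, Circle.norm_coe]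
    rw [norm_one, norm_mul, hfn, mul_one] at h2
    linarith
  rw [← one_div, le_div_iff₀ (by linarith)]
  exact (mul_le_mul_of_nonneg_left h1 (norm_nonneg _)).trans h.le

lemma enorm_cext_le {F : Torus → ℂ} {w : ℂ} {r : ℝ} (hr : r < 1) (hw : ‖w‖ ≤ r) :
    ‖cext F w‖ₑ ≤ ENNReal.ofReal (1 - r)⁻¹ * eLpNorm F 1 arcM := by
  rw [eLpNorm_one_eq_lintegral_enorm, ← lintegral_const_mul' _ _ (by simp)]
  refine (enorm_integral_le_lintegral_enorm _).trans (lintegral_mono fun x => ?_)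
  rw [enorm_mul]
  gcongr
  rw [← ofReal_norm]
  exact ENNReal.ofReal_le_ofReal (norm_cker_le hr hw x)

lemma cext_sub_res {F : Torus → ℂ} (hF : Integrable F arcM) {g : C(CD, ℂ)} (hg : g ∈ discAlg)
    {w : ℂ} (hw : ‖w‖ < 1) :
    cext (fun x => F x - res g x) w = cext F w - g ⟨w, by simpa using hw.le⟩ := by
  rw [← cext_res hg hw]
  simp only [cext, mul_sub]
  exact integral_sub (integrable_continuous_mul hF _)
    (integrable_continuous_mul (integrable_continuous _) _)

/-- The dilated boundary values of the Cauchy extension. -/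
def dilC (F : Torus → ℂ) (n : ℕ) (x : Torus) : ℂ := cext F (rad n * (bdry x : CD))

lemma continuous_dilC {F : Torus → ℂ} (hF : Integrable F arcM) (n : ℕ) :
    Continuous (dilC F n) := by
  refine (differentiableOn_cext hF).continuousOn.comp_continuous (by fun_prop) fun x => ?_
  rw [mem_ball_zero_iff]
  exact norm_rad_mul_lt (mem_closedBall_zero_iff.1 (bdry x).2)

lemma eLpNorm_dilC_sub_le {F : Torus → ℂ} (hF : MemLp F 2 arcM) (n : ℕ) {g : C(CD, ℂ)}
    (hg : g ∈ discAlg) :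
    eLpNorm (fun x => dilC F n x - res (dilate n g) x) 2 arcM ≤
      ENNReal.ofReal (1 - rad n)⁻¹ * eLpNorm (fun x => res g x - F x) 2 arcM := by
  have hFi : Integrable F arcM := hF.integrable (by norm_num)
  have h1 : ∀ x, ‖dilC F n x - res (dilate n g) x‖ₑ ≤
      ENNReal.ofReal (1 - rad n)⁻¹ * eLpNorm (fun x => res g x - F x) 2 arcM := fun x => by
    have hx : ‖((bdry x : CD) : ℂ)‖ ≤ 1 := mem_closedBall_zero_iff.1 (bdry x).2
    have h2 := cext_sub_res hFi hg (norm_rad_mul_lt (n := n) hx)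
    have h3 : dilC F n x - res (dilate n g) x = _ := h2.symm
    rw [h3]
    have h4 : ‖(rad n : ℂ) * (bdry x : CD)‖ ≤ rad n := by
      rw [norm_mul, Complex.norm_real, Real.norm_of_nonneg (rad_pos n).le]
      exact mul_le_of_le_one_right (rad_pos n).le hx
    refine (enorm_cext_le (rad_lt_one n) h4).trans ?_
    gcongr
    have h5 : (fun x => F x - res g x) = -fun x => res g x - F x := by ext x; simp
    rw [h5, eLpNorm_neg]
    exact eLpNorm_le_eLpNorm_of_exponent_le (by norm_num) ((memLp_res g).1.sub hF.1)
  refine (eLpNorm_mono_enorm (g := fun _ => ENNReal.ofReal (1 - rad n)⁻¹ *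
    eLpNorm (fun x => res g x - F x) 2 arcM) h1).trans ?_
  rw [eLpNorm_const _ (by norm_num) (NeZero.ne _)]
  simp

lemma L2Lim.eLpNorm_dilC_sub_le_self {F : Torus → ℂ} (hF : L2Lim discAlg F) (n : ℕ)
    {g : C(CD, ℂ)} (hg : g ∈ discAlg) :
    eLpNorm (fun x => dilC F n x - res (dilate n g) x) 2 arcM ≤
      eLpNorm (fun x => res g x - F x) 2 arcM := by
  obtain ⟨u, hu, hlim⟩ := hF.exists_seq
  have hFi : Integrable F arcM := hF.memLp.integrable (by norm_num)
  set C := ENNReal.ofReal (1 - rad n)⁻¹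
  have hk : ∀ k, eLpNorm (fun x => dilC F n x - res (dilate n g) x) 2 arcM ≤
      C * eLpNorm (fun x => res (u k) x - F x) 2 arcM +
        (eLpNorm (fun x => res (u k) x - F x) 2 arcM +
          eLpNorm (fun x => res g x - F x) 2 arcM) := by
    intro k
    have h1 : (fun x => dilC F n x - res (dilate n g) x) =
        (fun x => dilC F n x - res (dilate n (u k)) x) + res (dilate n (u k - g)) := by
      ext x; simp
    have h2 : (res (u k - g) : Torus → ℂ) =
        (fun x => res (u k) x - F x) - (fun x => res g x - F x) := by
      ext x; simp
    rw [h1]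
    refine (eLpNorm_add_le ((continuous_dilC hFi n).aestronglyMeasurable.sub (memLp_res _).1)
      (memLp_res _).1 (by norm_num)).trans (add_le_add (eLpNorm_dilC_sub_le hF.memLp n (hu k)) ?_)
    refine (eLpNorm_res_dilate_le n (discSub.sub_mem (hu k) hg)).trans ?_
    rw [h2]
    exact eLpNorm_sub_le ((memLp_res _).1.sub hF.memLp.1) ((memLp_res _).1.sub hF.memLp.1)
      (by norm_num)
  have h3 := (ENNReal.Tendsto.const_mul hlim (a := C) (Or.inr (by simp [C]))).add
    (hlim.add_const (eLpNorm (fun x => res g x - F x) 2 arcM))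
  rw [mul_zero, zero_add, zero_add] at h3
  exact ge_of_tendsto' h3 hk

lemma eLpNorm_le_norm (φ : C(Torus, ℂ)) : eLpNorm φ 2 arcM ≤ ENNReal.ofReal ‖φ‖ := by
  refine (eLpNorm_le_of_ae_bound (Eventually.of_forall φ.norm_coe_le_norm)).trans ?_
  simp

/-- Dilated Cauchy extensions converge in `L²` to the boundary values. -/
lemma L2Lim.tendsto_dilC {F : Torus → ℂ} (hF : L2Lim discAlg F) :
    Tendsto (fun n => eLpNorm (fun x => dilC F n x - F x) 2 arcM) atTop (𝓝 0) := by
  rw [ENNReal.tendsto_nhds_zero]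
  intro ε hε
  have hFi : Integrable F arcM := hF.memLp.integrable (by norm_num)
  have hε4 : ε / 2 / 2 ≠ 0 := by simpa using hε.ne'
  have hε2 : ε / 2 ≠ 0 := by simpa using hε.ne'
  obtain ⟨g, hg, h⟩ := hF.approx _ hε4
  have hlim : Tendsto (fun n => ENNReal.ofReal ‖res (dilate n g - g)‖) atTop (𝓝 0) := by
    have h1 : Tendsto (fun n => res (dilate n g - g)) atTop (𝓝 0) := by
      have h2 := (tendsto_dilate g).sub_const g
      rw [sub_self] at h2
      have h3 := (continuous_res.tendsto _).comp h2
      rw [map_zero] at h3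
      exact h3
    have h4 := (ENNReal.continuous_ofReal.tendsto _).comp h1.norm
    rw [norm_zero, ENNReal.ofReal_zero] at h4
    exact h4
  filter_upwards [hlim.eventually (eventually_le_nhds (pos_iff_ne_zero.2 hε2))] with n hn
  have h1 : (fun x => dilC F n x - F x) =
      ((fun x => dilC F n x - res (dilate n g) x) + res (dilate n g - g)) +
        fun x => res g x - F x := by
    ext x; simp
  have m1 : AEStronglyMeasurable (fun x => dilC F n x - res (dilate n g) x) arcM :=
    (continuous_dilC hFi n).aestronglyMeasurable.sub (memLp_res _).1
  rw [h1]
  refine (eLpNorm_add_le (m1.add (memLp_res _).1) ((memLp_res _).1.sub hF.memLp.1)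
    (by norm_num)).trans ?_
  refine (add_le_add_left (eLpNorm_add_le m1 (memLp_res _).1 (by norm_num)) _).trans ?_
  calc _ ≤ (ε / 2 / 2 + ε / 2) + ε / 2 / 2 := by
        gcongr
        · exact (hF.eLpNorm_dilC_sub_le_self n hg).trans h
        · exact (eLpNorm_le_norm _).trans hn
        · exact h
    _ = ε := by
        rw [add_right_comm, ENNReal.add_halves, ENNReal.add_halves]

lemma pairing_eq_zero_of_fourier {μ : Measure Torus} {G : Torus → ℂ} (hG : Integrable G μ)
    (h : ∀ n : ℤ, ∫ x, fourier n x * G x ∂μ = 0) (φ : C(Torus, ℂ)) :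
    ∫ x, φ x * G x ∂μ = 0 := by
  have hcl : IsClosed ((pairing μ G hG).ker : Set C(Torus, ℂ)) :=
    (pairing μ G hG).isClosed_ker
  have hsp : Submodule.span ℂ (range (fourier (T := 2 * Real.pi))) ≤ (pairing μ G hG).ker := by
    rw [Submodule.span_le]
    rintro _ ⟨n, rfl⟩
    exact h n
  have htop := Submodule.topologicalClosure_minimal _ hsp hcl
  rw [span_fourier_closure_eq_top] at htop
  exact htop (Submodule.mem_top (x := φ))

lemma ae_eq_const_of_fourier {v : Torus → ℝ} (hv : Integrable v arcM) (hv0 : ∀ x, 0 ≤ v x)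
    (h : ∀ n : ℤ, n ≠ 0 → ∫ x, fourier n x * (v x : ℂ) ∂arcM = 0) :
    ∀ᵐ x ∂arcM, v x = ∫ y, v y ∂arcM := by
  set c := ∫ y, v y ∂arcM with hc
  have hc0 : 0 ≤ c := integral_nonneg hv0
  have hG : Integrable (fun x => ((v x : ℂ) - c)) arcM := hv.ofReal.sub (integrable_const _)
  have hz := pairing_eq_zero_of_fourier hG fun n => by
    simp only [mul_sub]
    rw [integral_sub (f := fun x => fourier n x * (v x : ℂ)) (g := fun x => fourier n x * (c : ℂ))
      (integrable_continuous_mul hv.ofReal _)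
      (integrable_continuous_mul (integrable_const _) _), integral_mul_const]
    rcases eq_or_ne n 0 with rfl | hn
    · simp [integral_complex_ofReal, ← hc]
    · rw [h n hn, integral_fourier_of_ne hn]; simp
  have hfin : IsFiniteMeasure (arcM.withDensity fun x => ENNReal.ofReal (v x)) :=
    isFiniteMeasure_withDensity_ofReal hv.2
  have hfin' : IsFiniteMeasure (arcM.withDensity fun _ => ENNReal.ofReal c) :=
    isFiniteMeasure_withDensity_ofReal (integrable_const (μ := arcM) c).2
  have hwd : (arcM.withDensity fun x => ENNReal.ofReal (v x)) =
      arcM.withDensity fun _ => ENNReal.ofReal c := by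
    refine ext_of_forall_integral_eq_of_IsFiniteMeasure fun f => ?_
    rw [integral_withDensity_eq_integral_toReal_smul₀ hv.1.aemeasurable.ennreal_ofReal (by simp),
      integral_withDensity_eq_integral_toReal_smul₀ (by fun_prop) (by simp)]
    simp only [ENNReal.toReal_ofReal (hv0 _), ENNReal.toReal_ofReal hc0, smul_eq_mul]
    have h1 := hz ⟨fun x => (f x : ℂ), by fun_prop⟩
    have h2 : ∫ x, f x * (v x - c) ∂arcM = 0 := by
      have : ((∫ x, f x * (v x - c) ∂arcM : ℝ) : ℂ) = 0 := by
        rw [← integral_complex_ofReal, ← h1]; simp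
      exact_mod_cast this
    have hb : ∀ {w : Torus → ℝ}, Integrable w arcM → Integrable (fun x => f x * w x) arcM :=
      fun hw => hw.bdd_mul (c := ‖f‖) f.continuous.aestronglyMeasurable
        (Eventually.of_forall f.norm_coe_le_norm)
    simp only [mul_sub] at h2
    rw [integral_sub (hb hv) (hb (integrable_const c)), sub_eq_zero] at h2
    simpa [mul_comm] using h2
  have := (withDensity_eq_iff hv.1.aemeasurable.ennreal_ofReal (by fun_prop)
    (by rw [← ofReal_integral_eq_lintegral_ofReal hv (Eventually.of_forall hv0)]; simp)).1 hwd
  filter_upwards [this] with x hx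
  exact (ENNReal.ofReal_eq_ofReal_iff (hv0 x) hc0).1 hx

lemma eq_zero_of_fourier {f : C(Torus, ℂ)} (h : ∀ n : ℤ, ∫ x, fourier n x * f x ∂arcM = 0) :
    f = 0 := by
  have h0 : ∫ x, ‖f x‖ ^ 2 ∂arcM = 0 := by
    rw [← norm_toLp_sq]
    have h1 : ∀ k, fourierCoeff f k = 0 := fun k => h (-k)
    simp [h1]
  have hcont : Continuous fun x => ‖f x‖ ^ 2 := by fun_prop
  have h1 := (integral_eq_zero_iff_of_nonneg (fun x => by positivity)
    ((memLp_continuous hcont).integrable (by norm_num))).1 h0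
  have h2 := (hcont.ae_eq_iff_eq arcM continuous_zero).1 h1
  ext x
  simpa using congrFun h2 x

lemma exists_minimal_coeff {J : Set C(CD, ℂ)} (hJ : IsClosedIdealD J) {f : C(CD, ℂ)} (hf : f ∈ J)
    (hf0 : f ≠ 0) :
    ∃ k : ℕ, (∃ g ∈ J, ∫ x, fourier (-k : ℤ) x * res g x ∂arcM ≠ 0) ∧
      ∀ j < k, ∀ g ∈ J, ∫ x, fourier (-j : ℤ) x * res g x ∂arcM = 0 := by
  classical
  have hex : ∃ k : ℕ, ∃ g ∈ J, ∫ x, fourier (-k : ℤ) x * res g x ∂arcM ≠ 0 := by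
    by_contra! hcon
    apply hf0
    have h1 : res f = 0 := eq_zero_of_fourier fun n => by
      rcases le_or_gt n 0 with hn | hn
      · obtain ⟨m, hm⟩ := Int.eq_ofNat_of_zero_le (a := -n) (by omega)
        have : n = -(m : ℤ) := by omega
        rw [this]; exact hcon m f hf
      · obtain ⟨m, hm⟩ := Int.eq_ofNat_of_zero_le (a := n - 1) (by omega)
        have : n = (m : ℤ) + 1 := by omega
        rw [this]; exact (analyticOnCircle_res (hJ.subset hf)).coeff m
    rw [← norm_eq_zero, ← norm_res (hJ.subset hf), h1, norm_zero]
  refine ⟨Nat.find hex, Nat.find_spec hex, fun j hj g hg => ?_⟩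
  by_contra hne
  exact Nat.find_min hex hj ⟨g, hg, hne⟩

lemma integral_fourier_succ_sub_mul_res {g : C(CD, ℂ)} (hg : g ∈ discAlg) {k : ℕ}
    (hmin : ∀ j < k, ∫ x, fourier (-j : ℤ) x * res g x ∂arcM = 0) (n : ℕ) :
    ∫ x, fourier (n + 1 - k : ℤ) x * res g x ∂arcM = 0 := by
  rcases Nat.lt_or_ge n k with hk | hk
  · have := hmin (k - (n + 1)) (by omega)
    rwa [Nat.cast_sub (by omega), neg_sub, Nat.cast_succ] at this
  · have := (analyticOnCircle_res hg).coeff (n - k)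
    rw [Nat.cast_sub hk] at this
    rwa [add_sub_right_comm]

lemma exists_l2Lim_projection {J : Set C(CD, ℂ)} (hJ : IsClosedIdealD J) (φ : C(Torus, ℂ)) :
    ∃ W, L2Lim J W ∧ ∀ g ∈ J, ∫ x, res g x * starRingEnd ℂ (W x) ∂arcM =
      ∫ x, res g x * starRingEnd ℂ (φ x) ∂arcM := by
  let Js : Submodule ℂ C(CD, ℂ) :=
    { carrier := J
      add_mem' := fun {a b} ha hb => hJ.add_mem a ha b hb
      zero_mem' := hJ.zero_mem
      smul_mem' := fun c x hx => hJ.smul_mem c x hx }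
  let T : C(CD, ℂ) →ₗ[ℂ] Lp ℂ 2 arcM :=
    (ContinuousMap.toLp 2 arcM ℂ).toLinearMap ∘ₗ res.toLinearMap
  have hT : ∀ g, T g =ᵐ[arcM] res g := fun g => ContinuousMap.coeFn_toLp _ _
  let M : Submodule ℂ (Lp ℂ 2 arcM) := (Js.map T).topologicalClosure
  have : CompleteSpace M := (Submodule.isClosed_topologicalClosure _).completeSpace_coe
  let e : Lp ℂ 2 arcM := ContinuousMap.toLp 2 arcM ℂ φ
  have he : e =ᵐ[arcM] φ := ContinuousMap.coeFn_toLp _ _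
  let W : Lp ℂ 2 arcM := M.starProjection e
  have hW : W ∈ M := Submodule.starProjection_apply_mem _ _
  refine ⟨W, ⟨Lp.memLp W, fun ε hε => ?_⟩, fun g hg => ?_⟩
  · have hW' : W ∈ closure ((Js.map T : Submodule ℂ _) : Set (Lp ℂ 2 arcM)) := hW
    obtain ⟨_, ⟨g, hg, rfl⟩, hd⟩ := EMetric.mem_closure_iff.1 hW' ε (pos_iff_ne_zero.2 hε)
    refine ⟨g, hg, ?_⟩
    rw [edist_comm, Lp.edist_def] at hd
    refine le_trans (le_of_eq (eLpNorm_congr_ae ?_)) hd.le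
    filter_upwards [hT g] with x hx
    simp [hx]
  · have hgM : T g ∈ M := Submodule.le_topologicalClosure _ ⟨g, hg, rfl⟩
    have h1 : inner ℂ (e - W) (T g) = 0 :=
      (Submodule.mem_orthogonal' _ _).1 (Submodule.sub_starProjection_mem_orthogonal (K := M) e)
        _ hgM
    rw [inner_sub_left, sub_eq_zero, L2.inner_def, L2.inner_def] at h1
    have h2 : ∫ x, inner ℂ (W x) (T g x) ∂arcM = ∫ x, res g x * starRingEnd ℂ (W x) ∂arcM := by
      refine integral_congr_ae ?_
      filter_upwards [hT g] with x hx
      rw [hx]; simp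
    have h3 : ∫ x, inner ℂ (e x) (T g x) ∂arcM = ∫ x, res g x * starRingEnd ℂ (φ x) ∂arcM := by
      refine integral_congr_ae ?_
      filter_upwards [hT g, he] with x hx hx'
      rw [hx, hx']; simp
    rw [← h2, ← h3, h1]

/-- Beurling's theorem for the `L²` closure of a closed ideal of the disc algebra. -/
lemma exists_unimodular {J : Set C(CD, ℂ)} (hJ : IsClosedIdealD J) {f : C(CD, ℂ)} (hf : f ∈ J)
    (hf0 : f ≠ 0) :
    ∃ W, L2Lim J W ∧ (∀ᵐ x ∂arcM, ‖W x‖ = 1) ∧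
      ∀ g ∈ J, AnalyticOnCircle (fun x => res g x * starRingEnd ℂ (W x)) := by
  obtain ⟨k, ⟨g₀, hg₀, hne⟩, hmin⟩ := exists_minimal_coeff hJ hf hf0
  obtain ⟨W, hW, hWo⟩ := exists_l2Lim_projection hJ (fourier k)
  have hconj : ∀ x : Torus, starRingEnd ℂ (fourier (k : ℤ) x : ℂ) = fourier (-k : ℤ) x := fun x =>
    fourier_neg.symm
  have hWs : MemLp (fun x => starRingEnd ℂ (W x)) 2 arcM := hW.memLp.star
  have hcoef : ∀ g ∈ J, ∀ n : ℕ,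
      ∫ x, fourier (n + 1 : ℤ) x * (res g x * starRingEnd ℂ (W x)) ∂arcM = 0 := by
    intro g hg n
    have hz : coordD ^ (n + 1) * g ∈ J := hJ.mul_mem _ (discSub.pow_mem coordD_mem _) g hg
    have h1 := hWo _ hz
    have hr : ∀ x : Torus, res (coordD ^ (n + 1) * g) x = fourier (n + 1 : ℤ) x * res g x := fun x => by
      rw [map_mul, map_pow, res_coordD, ContinuousMap.mul_apply, ContinuousMap.pow_apply,
        fourier_apply, fourier_apply, ← Circle.coe_pow, ← AddCircle.toCircle_nsmul]
      simp only [one_smul]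
      norm_cast
    simp only [hr, hconj, mul_assoc] at h1
    rw [h1]
    have h2 : ∀ x : Torus, (fourier (n + 1 : ℤ) x : ℂ) * (res g x * fourier (-k : ℤ) x) =
        fourier (n + 1 - k : ℤ) x * res g x := fun x => by
      rw [sub_eq_add_neg, fourier_add (m := (n : ℤ) + 1) (n := -(k : ℤ))]; ring
    simp only [h2]
    exact integral_fourier_succ_sub_mul_res (hJ.subset hg) (fun j hj => hmin j hj g hg) n
  have hv : Integrable (fun x => ‖W x‖ ^ 2) arcM := by
    simpa using hW.memLp.integrable_norm_pow (by norm_num)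
  have hself : ∀ x, ((‖W x‖ ^ 2 : ℝ) : ℂ) = W x * starRingEnd ℂ (W x) := fun x => by
    rw [Complex.mul_conj, Complex.normSq_eq_norm_sq]
  have hpos : ∀ n : ℕ, ∫ x, fourier (n + 1 : ℤ) x * ((‖W x‖ ^ 2 : ℝ) : ℂ) ∂arcM = 0 := by
    intro n
    have h1 : ∀ x : Torus, fourier (n + 1 : ℤ) x * ((‖W x‖ ^ 2 : ℝ) : ℂ) =
        W x * (fourier (n + 1 : ℤ) x * starRingEnd ℂ (W x)) := fun x => by rw [hself]; ring
    simp only [h1]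
    refine hW.integral_eq_zero (memLp_continuous_mul _ hWs) fun g hg => ?_
    rw [← hcoef g hg n]
    congr 1; ext x; ring
  have hconst := ae_eq_const_of_fourier hv (fun x => by positivity) fun n hn => by
    rcases lt_or_gt_of_ne hn with h | h
    · obtain ⟨m, hm⟩ := Int.eq_ofNat_of_zero_le (a := -n - 1) (by omega)
      obtain rfl : n = -((m : ℤ) + 1) := by omega
      have h1 := congrArg (starRingEnd ℂ) (hpos m)
      rw [← integral_conj, map_zero] at h1
      rw [← h1]
      congr 1; ext x
      rw [map_mul, Complex.conj_ofReal, fourier_neg]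
    · obtain ⟨m, hm⟩ := Int.eq_ofNat_of_zero_le (a := n - 1) (by omega)
      obtain rfl : n = (m : ℤ) + 1 := by omega
      exact hpos m
  set c := ∫ x, ‖W x‖ ^ 2 ∂arcM
  have hc0 : 0 ≤ c := integral_nonneg fun x => by positivity
  have hc : c ≠ 0 := by
    intro h0
    apply hne
    have h1 := hWo g₀ hg₀
    simp only [hconj] at h1
    rw [integral_congr_ae (g := fun _ => 0), integral_zero] at h1
    · rw [h1]; congr 1; ext x; ring
    · filter_upwards [hconst] with x hx
      have : W x = 0 := by rw [h0] at hx; simpa using hx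
      simp [this]
  let s : ℝ := (Real.sqrt c)⁻¹
  have ha : algebraMap ℂ C(CD, ℂ) s ∈ discAlg := discSub.algebraMap_mem _
  have hra : ∀ x, res (algebraMap ℂ C(CD, ℂ) s) x = s := fun x => by
    rw [AlgHom.commutes]; rfl
  have hW' := hW.res_mul hJ ha
  simp only [hra] at hW'
  refine ⟨_, hW', ?_, fun g hg => ⟨(memLp_continuous_mul _ hW'.memLp.star).integrable
    (by norm_num), fun n => ?_⟩⟩
  · filter_upwards [hconst] with x hx
    have : ‖W x‖ = Real.sqrt c := by rw [← hx, Real.sqrt_sq (norm_nonneg _)]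
    rw [norm_mul, this, Complex.norm_real, Real.norm_of_nonneg (by positivity)]
    exact inv_mul_cancel₀ (Real.sqrt_ne_zero'.2 (hc0.lt_of_ne' hc))
  · have h1 : ∀ x : Torus, fourier (n + 1 : ℤ) x * (res g x * starRingEnd ℂ (s * W x)) =
        s * (fourier (n + 1 : ℤ) x * (res g x * starRingEnd ℂ (W x))) := fun x => by
      rw [map_mul, Complex.conj_ofReal]; ring
    simp only [h1]
    rw [integral_const_mul, hcoef g hg, mul_zero]

/-- Boundary values of the inner function generating the `L²` closure of `J`. -/
structure InnerGen (J : Set C(CD, ℂ)) (W : Torus → ℂ) : Prop where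
  lim : L2Lim J W
  norm_eq : ∀ᵐ x ∂arcM, ‖W x‖ = 1
  analytic : ∀ g ∈ J, AnalyticOnCircle (fun x => res g x * starRingEnd ℂ (W x))

lemma tendsto_apply_cext {u : ℕ → C(CD, ℂ)} (hu : ∀ n, u n ∈ discAlg) {F : Torus → ℂ}
    (hF : MemLp F 2 arcM)
    (h : Tendsto (fun n => eLpNorm (fun x => res (u n) x - F x) 2 arcM) atTop (𝓝 0))
    {w : ℂ} (hw : ‖w‖ < 1) :
    Tendsto (fun n => u n ⟨w, by simpa using hw.le⟩) atTop (𝓝 (cext F w)) := by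
  have h1 := L2Lim.tendsto_integral h hF (memLp_continuous (cker w).continuous)
  simp only [mul_comm _ (cker w _)] at h1
  refine h1.congr fun n => ?_
  exact cext_res (hu n) hw

lemma InnerGen.eq_mul {J : Set C(CD, ℂ)} (hJ : IsClosedIdealD J) {W : Torus → ℂ}
    (hW : InnerGen J W) {g : C(CD, ℂ)} (hg : g ∈ J) {w : ℂ} (hw : ‖w‖ < 1) :
    g ⟨w, by simpa using hw.le⟩ =
      cext W w * cext (fun x => res g x * starRingEnd ℂ (W x)) w := by
  obtain ⟨u, hu, hlim⟩ := hW.lim.exists_seq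
  have hG : MemLp (fun x => cker w x * (res g x * starRingEnd ℂ (W x))) 2 arcM :=
    memLp_continuous_mul _ (memLp_continuous_mul _ hW.lim.memLp.star)
  have h1 := L2Lim.tendsto_integral hlim hW.lim.memLp hG
  have h2 := (tendsto_apply_cext (fun n => hJ.subset (hu n)) hW.lim.memLp hlim hw).mul_const
    (cext (fun x => res g x * starRingEnd ℂ (W x)) w)
  refine Eq.trans ?_ (tendsto_nhds_unique (h1.congr fun n => ?_) h2)
  · rw [← cext_res (hJ.subset hg) hw]
    refine integral_congr_ae ?_
    filter_upwards [hW.norm_eq] with x hx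
    have : W x * starRingEnd ℂ (W x) = 1 := by
      rw [Complex.mul_conj, Complex.normSq_eq_norm_sq, hx]; norm_num
    linear_combination -(cker w x * res g x) * this
  · rw [← cext_res_mul (hW.analytic g hg) hw (u n) (hJ.subset (hu n))]
    simp only [cext]
    congr 1; ext x; ring

lemma isHinf_cext {F : Torus → ℂ} (hF : AnalyticOnCircle F) {C : ℝ}
    (hC : ∀ᵐ x ∂arcM, ‖F x‖ ≤ C) : IsHinf (cext F) :=
  ⟨differentiableOn_cext hF.integrable, C, fun _ hz =>
    norm_cext_le hF hC (mem_ball_zero_iff.1 hz)⟩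

lemma InnerGen.isHinf_quotient {J : Set C(CD, ℂ)} {W : Torus → ℂ} (hW : InnerGen J W)
    {g : C(CD, ℂ)} (hg : g ∈ J) :
    IsHinf (cext (fun x => res g x * starRingEnd ℂ (W x))) := by
  refine isHinf_cext (hW.analytic g hg) (C := ‖res g‖) ?_
  filter_upwards [hW.norm_eq] with x hx
  rw [norm_mul, RCLike.norm_conj, hx, mul_one]
  exact (res g).norm_coe_le_norm x

lemma polynomial_mem_discAlg (p : Polynomial ℂ) : Polynomial.aeval coordD p ∈ discAlg := by
  refine Subalgebra.le_topologicalClosure _ ?_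
  show _ ∈ Algebra.adjoin ℂ {coordD}
  rw [Algebra.adjoin_singleton_eq_range_aeval]
  exact ⟨_, rfl⟩

lemma exists_dilation {h : ℂ → ℂ} (hh : DifferentiableOn ℂ h (ball 0 1)) (n : ℕ) :
    ∃ a ∈ discAlg, ∀ z : CD, a z = h (rad n * z) := by
  let φ : C(CD, ℂ) := ⟨fun z => h (rad n * z), hh.continuousOn.comp_continuous (by fun_prop)
    fun z => mem_ball_zero_iff.2 (norm_rad_mul_lt (mem_closedBall_zero_iff.1 z.2))⟩
  refine ⟨φ, ?_, fun z => rfl⟩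
  obtain ⟨R, hR, hR1⟩ := exists_between (rad_lt_one n)
  obtain ⟨r, hr, hr1⟩ := exists_between hR
  have hr0 : 0 < r := (rad_pos n).trans hr
  have hR0 : 0 < R := (rad_pos n).trans hR
  lift R to NNReal using hR0.le
  lift r to NNReal using hr0.le
  have hps := (hh.mono (closedBall_subset_ball hR1)).hasFPowerSeriesOnBall (by exact_mod_cast hR0)
  have hu := hps.tendstoUniformlyOn (r' := r) (by exact_mod_cast hr1)
  set p := cauchyPowerSeries h 0 R
  let q : ℕ → C(CD, ℂ) := fun N =>
    Polynomial.aeval coordD (∑ k ∈ Finset.range N, Polynomial.monomial k ((rad n : ℂ) ^ k * p.coeff k))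
  have hq : Tendsto q atTop (𝓝 φ) := by
    rw [ContinuousMap.tendsto_iff_tendstoUniformly, Metric.tendstoUniformly_iff]
    intro ε hε
    filter_upwards [Metric.tendstoUniformlyOn_iff.1 hu ε hε] with N hN z
    have hz : (rad n : ℂ) * z ∈ ball (0 : ℂ) r := by
      rw [mem_ball_zero_iff, norm_mul, Complex.norm_real, Real.norm_of_nonneg (rad_pos n).le]
      exact (mul_le_of_le_one_right (rad_pos n).le (mem_closedBall_zero_iff.1 z.2)).trans_lt hr
    have := hN _ hz
    rw [zero_add] at this
    suffices hqz : q N z = p.partialSum N (rad n * z) by rw [hqz]; exact this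
    simp only [q, map_sum, ContinuousMap.sum_apply, FormalMultilinearSeries.partialSum,
      Polynomial.aeval_monomial, FormalMultilinearSeries.apply_eq_pow_smul_coeff]
    refine Finset.sum_congr rfl fun k _ => ?_
    rw [mul_pow, smul_eq_mul]
    have : (coordD ^ k) z = (z : ℂ) ^ k := rfl
    rw [ContinuousMap.mul_apply, this]
    simp
    ring
  exact isClosed_discSub.mem_of_tendsto hq (Eventually.of_forall fun N => polynomial_mem_discAlg _)

lemma InnerGen.l2Lim_of_eq_mul {J : Set C(CD, ℂ)} (hJ : IsClosedIdealD J) {W : Torus → ℂ}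
    (hW : InnerGen J W) {f : C(CD, ℂ)} {h : ℂ → ℂ} (hh : IsHinf h)
    (heq : ∀ w (hw : ‖w‖ < 1), f ⟨w, by simpa using hw.le⟩ = cext W w * h w) :
    L2Lim J (res f) := by
  obtain ⟨hd, C, hC⟩ := hh
  choose a ha hah using exists_dilation hd
  have hWA : L2Lim discAlg W := hW.lim.mono hJ.subset
  have hC0 : 0 ≤ C := (norm_nonneg _).trans (hC 0 (by simp))
  refine L2Lim.of_approx (memLp_res f) fun ε hε => ?_
  have hlim : Tendsto (fun n => ENNReal.ofReal C * eLpNorm (fun x => dilC W n x - W x) 2 arcM +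
      ENNReal.ofReal ‖res (dilate n f - f)‖) atTop (𝓝 0) := by
    have h1 := (continuous_res.tendsto _).comp ((tendsto_dilate f).sub_const f)
    rw [sub_self, map_zero] at h1
    have h2 := (ENNReal.continuous_ofReal.tendsto _).comp h1.norm
    rw [norm_zero, ENNReal.ofReal_zero] at h2
    have h3 := (ENNReal.Tendsto.const_mul hWA.tendsto_dilC
      (a := ENNReal.ofReal C) (Or.inr (by simp))).add h2
    rw [mul_zero, zero_add] at h3
    exact h3
  obtain ⟨n, hn⟩ := (hlim.eventually (eventually_le_nhds (pos_iff_ne_zero.2 hε))).exists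
  refine ⟨_, hW.lim.res_mul hJ (ha n), le_trans ?_ hn⟩
  have hb : ∀ x, ‖((bdry x : CD) : ℂ)‖ ≤ 1 := fun x => mem_closedBall_zero_iff.1 (bdry x).2
  have h1 : (fun x => res (a n) x * W x - res f x) =
      (fun x => -(res (a n) x * (dilC W n x - W x))) + res (dilate n f - f) := by
    ext x
    have h2 : res (dilate n f) x = dilC W n x * res (a n) x := by
      rw [res_apply, res_apply, hah]
      exact heq _ (norm_rad_mul_lt (hb x))
    simp only [Pi.add_apply, map_sub, ContinuousMap.sub_apply, h2]
    ring
  have m1 : AEStronglyMeasurable (fun x => dilC W n x - W x) arcM :=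
    (continuous_dilC (hW.lim.memLp.integrable (by norm_num)) n).aestronglyMeasurable.sub
      hW.lim.memLp.1
  rw [h1]
  refine (eLpNorm_add_le ((res (a n)).continuous.aestronglyMeasurable.mul m1).neg (memLp_res _).1
    (by norm_num)).trans (add_le_add ?_ (eLpNorm_le_norm _))
  refine eLpNorm_le_mul_eLpNorm_of_ae_le_mul (Eventually.of_forall fun x => ?_) 2
  show ‖-(res (a n) x * (dilC W n x - W x))‖ ≤ _
  rw [norm_neg, norm_mul]
  gcongr
  rw [res_apply, hah]
  exact hC _ (mem_ball_zero_iff.2 (norm_rad_mul_lt (hb x)))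

lemma sq_mul_exp_neg_le {t v : ℝ} (ht : 0 < t) (hv : 0 ≤ v) :
    v ^ 2 * Real.exp (-t * v) ≤ 2 / t ^ 2 := by
  have h1 := Real.quadratic_le_exp_of_nonneg (mul_nonneg ht.le hv)
  have h2 : Real.exp (-t * v) * Real.exp (t * v) = 1 := by rw [← Real.exp_add]; simp
  have h3 := Real.exp_pos (-t * v)
  rw [le_div_iff₀ (by positivity)]
  have h4 : (t * v) ^ 2 / 2 ≤ Real.exp (t * v) := by nlinarith [mul_nonneg ht.le hv]
  nlinarith

/-- An absolutely continuous functional that annihilates `J` annihilates those continuous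
functions that are `L²` limits of elements of `J`. -/
lemma L2Lim.integral_res_mul_eq_zero {J : Set C(CD, ℂ)} (hJ : IsClosedIdealD J) {w : Torus → ℂ}
    (hw : Integrable w arcM) (h : ∀ g ∈ J, ∫ x, res g x * w x ∂arcM = 0) {f : C(CD, ℂ)}
    (hf : L2Lim J (res f)) : ∫ x, res f x * w x ∂arcM = 0 := by
  have hv : MemLp (fun x => Real.sqrt ‖w x‖) 2 arcM := by
    refine (memLp_two_iff_integrable_sq
      (Real.continuous_sqrt.comp_aestronglyMeasurable hw.1.norm)).2 ?_
    simpa [Real.sq_sqrt] using hw.norm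
  obtain ⟨P, F, hP, hre, hFm, hlim, hF⟩ := exists_analytic_completion hv fun _ => Real.sqrt_nonneg _
  have hdom : ∀ g : C(CD, ℂ), Integrable (fun x => ‖res g‖ * ‖w x‖) arcM := fun g =>
    hw.norm.const_mul _
  have hbound : ∀ (g : C(CD, ℂ)) (x : Torus) (c : ℂ), ‖c‖ ≤ 1 →
      ‖res g x * (w x * c)‖ ≤ ‖res g‖ * ‖w x‖ := fun g x c hc => by
    rw [norm_mul, norm_mul]
    have := (res g).norm_coe_le_norm x
    gcongr
    exact mul_le_of_le_one_right (norm_nonneg _) hc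
  have hexp : ∀ t : ℝ, Continuous fun z : ℂ => Complex.exp (-t * z) := fun t => by fun_prop
  have hOm : ∀ t : ℝ, AEStronglyMeasurable (fun x => Complex.exp (-t * F x)) arcM := fun t =>
    (hexp t).comp_aestronglyMeasurable hFm
  have hJ0 : ∀ t : ℝ, 0 < t → ∀ g ∈ J,
      ∫ x, res g x * (w x * Complex.exp (-t * F x)) ∂arcM = 0 := by
    intro t ht g hg
    have hz : ∀ j, ∫ x, res g x * (w x * Complex.exp (-t * res (P j) x)) ∂arcM = 0 := fun j => by
      rw [← h _ (hJ.mul_mem _ (exp_neg_smul_mem (hP j) t) g hg)]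
      congr 1; ext x
      rw [map_mul, ContinuousMap.mul_apply, res_exp_neg_smul]; ring
    refine tendsto_nhds_unique (tendsto_integral_of_dominated_convergence _ (fun j => ?_) (hdom g)
      (fun j => Eventually.of_forall fun x => hbound g x _ ?_) ?_)
      (tendsto_const_nhds.congr fun j => (hz j).symm)
    · exact (res g).continuous.aestronglyMeasurable.mul
        (hw.1.mul ((hexp t).comp (res (P j)).continuous).aestronglyMeasurable)
    · rw [Complex.norm_exp, Real.exp_le_one_iff]
      simpa using mul_nonneg ht.le (hre j x)
    · filter_upwards [hlim] with x hx
      exact (((hexp t).tendsto _).comp hx).const_mul _ |>.const_mul _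
  have hf0 : ∀ t : ℝ, 0 < t → ∫ x, res f x * (w x * Complex.exp (-t * F x)) ∂arcM = 0 := by
    intro t ht
    refine hf.integral_eq_zero (MemLp.of_bound (hw.1.mul (hOm t)) (2 / t ^ 2) ?_) (hJ0 t ht)
    filter_upwards [hF] with x hx
    have := sq_mul_exp_neg_le ht (Real.sqrt_nonneg ‖w x‖)
    rw [Real.sq_sqrt (norm_nonneg _)] at this
    rw [norm_mul, Complex.norm_exp]
    simpa [hx] using this
  let t : ℕ → ℝ := fun n => 1 / ((n : ℝ) + 1)
  have ht : ∀ n, 0 < t n := fun n => by positivity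
  refine tendsto_nhds_unique (tendsto_integral_of_dominated_convergence
    (F := fun n x => res f x * (w x * Complex.exp (-t n * F x))) _ (fun n => ?_) (hdom f)
      (fun n => ?_) ?_) (tendsto_const_nhds.congr fun n => (hf0 _ (ht n)).symm)
  · exact (res f).continuous.aestronglyMeasurable.mul (hw.1.mul (hOm _))
  · filter_upwards [hF] with x hx
    refine hbound f x _ ?_
    rw [Complex.norm_exp, Real.exp_le_one_iff]
    simpa [hx] using mul_nonneg (ht n).le (Real.sqrt_nonneg ‖w x‖)
  · refine Eventually.of_forall fun x => ?_
    have h1 : Tendsto (fun n => Complex.exp (-t n * F x)) atTop (𝓝 1) := by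
      have h2 : Continuous fun s : ℝ => Complex.exp (-s * F x) := by fun_prop
      have h3 := (h2.tendsto 0).comp tendsto_one_div_add_atTop_nhds_zero_nat
      simpa [Function.comp_def, t] using h3
    simpa using (h1.const_mul (w x)).const_mul (res f x)

lemma exists_seq_discAlg_peak_of_mutuallySingular {μ : Measure Torus} [IsFiniteMeasure μ]
    (hμ : μ ⟂ₘ arcM) :
    ∃ e : ℕ → C(CD, ℂ), (∀ j, e j ∈ discAlg) ∧ (∀ j x, ‖res (e j) x‖ ≤ 1) ∧
      Tendsto (fun j => e j ⟨0, by simp⟩) atTop (𝓝 1) ∧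
      (∀ᵐ x ∂arcM, Tendsto (fun j => res (e j) x) atTop (𝓝 1)) ∧
      ∀ᵐ x ∂μ, Tendsto (fun j => res (e j) x) atTop (𝓝 0) := by
  obtain ⟨S, hS, h1, h2⟩ := hμ
  obtain ⟨e, he, hb, h0, ha, hs⟩ := exists_seq_discAlg_peak μ hS.compl h2
  refine ⟨e, he, hb, h0, ha, ?_⟩
  have : ∀ᵐ x ∂μ, x ∈ Sᶜ := by rw [ae_iff]; simpa using h1
  filter_upwards [hs, this] with x hx hx'
  exact hx hx'

lemma tendsto_integral_res_mul {μ : Measure Torus} {u : Torus → ℂ} (hu : Integrable u μ)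
    {e : ℕ → C(CD, ℂ)} (hb : ∀ j x, ‖res (e j) x‖ ≤ 1) {c : ℂ}
    (h : ∀ᵐ x ∂μ, Tendsto (fun j => res (e j) x) atTop (𝓝 c)) :
    Tendsto (fun j => ∫ x, res (e j) x * u x ∂μ) atTop (𝓝 (∫ x, c * u x ∂μ)) := by
  refine tendsto_integral_of_dominated_convergence (fun x => ‖u x‖)
    (fun j => (res (e j)).continuous.aestronglyMeasurable.mul hu.1) hu.norm
    (fun j => Eventually.of_forall fun x => ?_) ?_
  · rw [norm_mul]; exact mul_le_of_le_one_left (norm_nonneg _) (hb j x)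
  · filter_upwards [h] with x hx using hx.mul_const _

/-- The singular half of the F. and M. Riesz theorem. -/
lemma integral_mul_eq_zero_of_mutuallySingular {μ : Measure Torus} [IsFiniteMeasure μ]
    (hμ : μ ⟂ₘ arcM) {u : Torus → ℂ} (hu : Integrable u μ)
    (h : ∀ a ∈ discAlg, ∫ x, res a x * u x ∂μ = 0) (φ : C(Torus, ℂ)) :
    ∫ x, φ x * u x ∂μ = 0 := by
  obtain ⟨e, he, hb, he0, -, hes⟩ := exists_seq_discAlg_peak_of_mutuallySingular hμ
  have step : ∀ v : Torus → ℂ, Integrable v μ → (∀ a ∈ discAlg, ∫ x, res a x * v x ∂μ = 0) →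
      ∀ a ∈ discAlg, ∫ x, res a x * (fourier (-1) x * v x) ∂μ = 0 := by
    intro v hv h0
    have hv' := integrable_continuous_mul hv (fourier (-1))
    set ℓ := pairing μ _ hv'
    have key : ∀ a ∈ discAlg, ℓ (res a) = a ⟨0, by simp⟩ * ℓ 1 := by
      refine discAlg_induction ?_ ?_ ?_ ?_ ?_
      · exact isClosed_eq (ℓ.continuous.comp continuous_res)
          ((continuous_eval_const _).mul continuous_const)
      · simp
      · intro f hf _
        have : (coordD * f) ⟨0, by simp⟩ = 0 := by
          rw [ContinuousMap.mul_apply]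
          exact zero_mul _
        rw [this, zero_mul, pairing_apply, ← h0 f hf]
        congr 1; ext x
        rw [map_mul, res_coordD, ContinuousMap.mul_apply]
        linear_combination (res f x * v x) * fourier_one_mul_neg x
      · intro f g hf hg
        rw [map_add, map_add, hf, hg, ContinuousMap.add_apply, add_mul]
      · intro c f hf
        rw [map_smul, map_smul, hf, ContinuousMap.smul_apply, smul_eq_mul, smul_eq_mul, mul_assoc]
    have h1 : ℓ 1 = 0 := by
      have h2 := tendsto_integral_res_mul hv' hb hes
      have h3 := (he0.mul_const (ℓ 1)).congr fun j => (key (e j) (he j)).symm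
      have h4 := tendsto_nhds_unique h3 h2
      simpa using h4
    intro a ha
    have := key a ha
    rwa [h1, mul_zero] at this
  have hall : ∀ n : ℕ, ∀ a ∈ discAlg, ∫ x, res a x * (fourier (-n : ℤ) x * u x) ∂μ = 0 := by
    intro n
    induction n with
    | zero => simpa using h
    | succ n ih =>
      intro a ha
      rw [← step _ (integrable_continuous_mul hu _) ih a ha]
      congr 1; ext x
      rw [Nat.cast_succ, neg_add_rev, fourier_add]; ring
  refine pairing_eq_zero_of_fourier hu (fun n => ?_) φ
  rcases le_or_gt n 0 with hn | hn
  · obtain ⟨m, hm⟩ := Int.eq_ofNat_of_zero_le (a := -n) (by omega)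
    obtain rfl : n = -(m : ℤ) := by omega
    simpa using hall m 1 discSub.one_mem
  · obtain ⟨m, rfl⟩ := Int.eq_ofNat_of_zero_le hn.le
    rw [← h _ (discSub.pow_mem coordD_mem m)]
    congr 1; ext x
    rw [map_pow, res_coordD, ContinuousMap.pow_apply, fourier_apply, fourier_apply,
      ← Circle.coe_pow, ← AddCircle.toCircle_nsmul]
    simp

lemma exists_dual_annihilator {E : Type*} [NormedAddCommGroup E] [NormedSpace ℂ E]
    {M : Submodule ℂ E} (hM : IsClosed (M : Set E)) {x : E} (hx : x ∉ M) :
    ∃ ℓ : E →L[ℂ] ℂ, (∀ y ∈ M, ℓ y = 0) ∧ ℓ x ≠ 0 := by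
  obtain ⟨ℓ, c, h1, h2⟩ := RCLike.geometric_hahn_banach_closed_point (𝕜 := ℂ)
    (M.restrictScalars ℝ).convex hM hx
  have hc : 0 < c := by simpa using h1 0 M.zero_mem
  refine ⟨ℓ, fun y hy => ?_, fun h0 => ?_⟩
  · by_contra hne
    have := h1 (((c : ℂ) / ℓ y) • y) (M.smul_mem _ hy)
    rw [map_smul, smul_eq_mul, div_mul_cancel₀ _ hne] at this
    simp at this
  · rw [h0] at h2
    simp at h2
    linarith

lemma isClosed_res_image {J : Set C(CD, ℂ)} (hJ : IsClosedIdealD J) : IsClosed (res '' J) := by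
  have : CompleteSpace J := hJ.closed.completeSpace_coe
  have hi : Isometry fun g : J => res (g : C(CD, ℂ)) := by
    refine Isometry.of_dist_eq fun g g' => ?_
    rw [dist_eq_norm, ← map_sub, norm_res (discSub.sub_mem (hJ.subset g.2) (hJ.subset g'.2)),
      Subtype.dist_eq, dist_eq_norm]
  have := hi.isClosedEmbedding.isClosed_range
  rwa [show range (fun g : J => res (g : C(CD, ℂ))) = res '' J from by
    ext y; simp] at this

lemma L2Lim.mem_of_vanish {J : Set C(CD, ℂ)} (hJ : IsClosedIdealD J) {f : C(CD, ℂ)}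
    (hfA : f ∈ discAlg) (hf : L2Lim J (res f))
    (hK : ∀ x, (∀ g ∈ J, res g x = 0) → res f x = 0) : f ∈ J := by
  by_contra hfJ
  let Js : Submodule ℂ C(CD, ℂ) :=
    { carrier := J
      add_mem' := fun {a b} ha hb => hJ.add_mem a ha b hb
      zero_mem' := hJ.zero_mem
      smul_mem' := fun c x hx => hJ.smul_mem c x hx }
  have hx : res f ∉ Js.map res.toLinearMap := by
    rintro ⟨g, hg, hgf⟩
    have h1 : ‖g - f‖ = 0 := by
      rw [← norm_res (discSub.sub_mem (hJ.subset hg) hfA), map_sub]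
      exact norm_eq_zero.2 (sub_eq_zero.2 hgf)
    rw [norm_eq_zero, sub_eq_zero] at h1
    exact hfJ (h1 ▸ hg)
  obtain ⟨ℓ, hℓ, hℓf⟩ := exists_dual_annihilator (isClosed_res_image hJ) hx
  have hℓJ : ∀ g ∈ J, ℓ (res g) = 0 := fun g hg => hℓ _ ⟨g, hg, rfl⟩
  obtain ⟨μ, u, hμ, -, hu2, hu⟩ := exists_measure_density ℓ
  have hui : Integrable u μ := hu2.integrable (by norm_num)
  set μ₂ := μ.singularPart arcM
  set μ₁ := arcM.withDensity (μ.rnDeriv arcM)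
  have hdec : μ = μ₂ + μ₁ := (Measure.haveLebesgueDecomposition_add μ arcM)
  have hu₁ : Integrable u μ₁ := hui.mono_measure (by rw [hdec]; exact Measure.le_add_left le_rfl)
  have hu₂ : Integrable u μ₂ := hui.mono_measure (by rw [hdec]; exact Measure.le_add_right le_rfl)
  have hsing : μ₂ ⟂ₘ arcM := Measure.mutuallySingular_singularPart _ _
  have hac : μ₁ ≪ arcM := withDensity_absolutelyContinuous _ _
  have hsplit : ∀ φ : C(Torus, ℂ), ℓ φ = ∫ x, φ x * u x ∂μ₂ + ∫ x, φ x * u x ∂μ₁ := fun φ => by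
    rw [hu, hdec]
    exact integral_add_measure (integrable_continuous_mul hu₂ φ) (integrable_continuous_mul hu₁ φ)
  obtain ⟨e, he, hb, -, hea, hes⟩ := exists_seq_discAlg_peak_of_mutuallySingular hsing
  have hJ₁ : ∀ g ∈ J, ∫ x, res g x * u x ∂μ₁ = 0 := by
    intro g hg
    have h1 := tendsto_integral_res_mul (integrable_continuous_mul hu₂ (res g)) hb hes
    have h2 := tendsto_integral_res_mul (integrable_continuous_mul hu₁ (res g)) hb (hac.ae_le hea)
    have h3 := h1.add h2
    simp only [zero_mul, integral_zero, zero_add, one_mul] at h3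
    refine tendsto_nhds_unique h3 (tendsto_const_nhds.congr fun j => ?_)
    rw [← hℓJ _ (hJ.mul_mem _ (he j) g hg), hsplit]
    simp only [map_mul, ContinuousMap.mul_apply, mul_assoc]
  have hf₁ : ∫ x, res f x * u x ∂μ₁ = 0 := by
    have hden : ∀ φ : C(Torus, ℂ), ∫ x, φ x * u x ∂μ₁ =
        ∫ x, φ x * ((μ.rnDeriv arcM x).toReal * u x) ∂arcM := fun φ => by
      rw [integral_withDensity_eq_integral_toReal_smul (Measure.measurable_rnDeriv _ _)
        (Measure.rnDeriv_lt_top _ _)]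
      congr 1; ext x
      rw [Complex.real_smul]; ring
    have hw : Integrable (fun x => ((μ.rnDeriv arcM x).toReal : ℂ) * u x) arcM := by
      have := (integrable_withDensity_iff_integrable_smul' (Measure.measurable_rnDeriv _ _)
        (Measure.rnDeriv_lt_top _ _)).1 hu₁
      simpa only [Complex.real_smul] using this
    rw [hden]
    exact hf.integral_res_mul_eq_zero hJ hw fun g hg => by rw [← hden, hJ₁ g hg]
  have hJ₂ : ∀ g ∈ J, ∀ φ : C(Torus, ℂ), ∫ x, φ x * (res g x * u x) ∂μ₂ = 0 := by
    intro g hg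
    refine integral_mul_eq_zero_of_mutuallySingular hsing (integrable_continuous_mul hu₂ _)
      fun a ha => ?_
    have h1 := hsplit (res (a * g))
    rw [hJ₁ _ (hJ.mul_mem a ha g hg), add_zero, hℓJ _ (hJ.mul_mem a ha g hg)] at h1
    rw [h1]
    simp only [map_mul, ContinuousMap.mul_apply, mul_assoc]
  let I : Ideal C(Torus, ℂ) :=
    { carrier := {ψ | ∀ φ : C(Torus, ℂ), pairing μ₂ u hu₂ (φ * ψ) = 0}
      add_mem' := fun {a b} ha hb φ => by rw [mul_add, map_add, ha, hb, add_zero]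
      zero_mem' := fun φ => by rw [mul_zero, map_zero]
      smul_mem' := fun c ψ hψ φ => by rw [smul_eq_mul, ← mul_assoc]; exact hψ _ }
  have hI : IsClosed (I : Set C(Torus, ℂ)) := by
    show IsClosed {ψ | ∀ φ : C(Torus, ℂ), pairing μ₂ u hu₂ (φ * ψ) = 0}
    rw [Set.ofPred_forall]
    exact isClosed_iInter fun φ => isClosed_eq
      ((pairing μ₂ u hu₂).continuous.comp (continuous_const.mul continuous_id)) continuous_const
  have hJI : ∀ g ∈ J, res g ∈ I := fun g hg φ => by
    rw [pairing_apply, ← hJ₂ g hg φ]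
    simp only [ContinuousMap.mul_apply, mul_assoc]
  have hfI : res f ∈ I := by
    rw [← ContinuousMap.idealOfSet_ofIdeal_isClosed hI, ContinuousMap.mem_idealOfSet]
    intro x hx
    have hx' := ContinuousMap.notMem_setOfIdeal.1 hx
    exact hK x fun g hg => hx' (hJI g hg)
  have hf₂ : ∫ x, res f x * u x ∂μ₂ = 0 := by
    have := hfI 1
    rwa [one_mul] at this
  exact hℓf (by rw [hsplit, hf₁, hf₂, add_zero])

lemma measure_commonZeros_eq_zero {J : Set C(CD, ℂ)} (hJ : IsClosedIdealD J) {f : C(CD, ℂ)}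
    (hf : f ∈ J) (hf0 : f ≠ 0) : arcM {x | ∀ g ∈ J, res g x = 0} = 0 := by
  obtain ⟨k, ⟨g, hg, hne⟩, hmin⟩ := exists_minimal_coeff hJ hf hf0
  have hG : AnalyticOnCircle (fun x => fourier (-k : ℤ) x * res g x) := by
    refine ⟨integrable_continuous_mul (integrable_continuous _) _, fun n => ?_⟩
    rw [← integral_fourier_succ_sub_mul_res (hJ.subset hg) (fun j hj => hmin j hj g hg) n]
    congr 1; ext x
    rw [sub_eq_add_neg, fourier_add (m := (n : ℤ) + 1) (n := -(k : ℤ))]; ring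
  have hE : MeasurableSet {x | res g x = 0} :=
    (isClosed_eq (res g).continuous continuous_const).measurableSet
  exact measure_mono_null (fun x hx => hx g hg)
    (hG.measure_eq_zero hne hE fun x hx => by
      have hx' : res g x = 0 := hx
      simp only [hx', mul_zero])

lemma coe_bdry_mk (θ : ℝ) : ((bdry (θ : Torus) : CD) : ℂ) = Complex.exp (θ * Complex.I) := by
  show ((AddCircle.toCircle (θ : Torus) : Circle) : ℂ) = _
  rw [AddCircle.toCircle_apply_mk, Circle.coe_exp]
  congr 2
  rw [div_self Real.two_pi_pos.ne', one_mul]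

lemma ae_restrict_Ico_of_ae_arcM {p : Torus → Prop} (h : ∀ᵐ x ∂arcM, p x) :
    ∀ᵐ θ : ℝ ∂(volume.restrict (Ico 0 (2 * Real.pi))), p (θ : Torus) := by
  have h1 : ∀ᵐ x ∂(volume : Measure Torus), p x := by
    rw [AddCircle.volume_eq_smul_haarAddCircle]
    exact Measure.ae_smul_measure h _
  have h2 := (AddCircle.measurePreserving_mk (2 * Real.pi) 0).quasiMeasurePreserving.ae h1
  rw [zero_add, ← restrict_Ico_eq_restrict_Ioc] at h2
  exact h2

lemma sub_const_mem_closure {ζ : CD} : ∀ f ∈ discAlg,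
    f - f ζ • 1 ∈ ((discSub.toSubmodule.map
      (LinearMap.mulLeft ℂ ((ζ : ℂ) • 1 - coordD))).topologicalClosure : Submodule ℂ C(CD, ℂ)) := by
  set N := discSub.toSubmodule.map (LinearMap.mulLeft ℂ ((ζ : ℂ) • 1 - coordD))
  refine discAlg_induction ?_ ?_ ?_ ?_ ?_
  · exact (Submodule.isClosed_topologicalClosure N).preimage
      (continuous_id.sub ((continuous_eval_const ζ).smul continuous_const))
  · simp
  · intro f hf h
    have h1 : coordD * f - (coordD * f) ζ • 1 =
        ((ζ : ℂ) • 1 - coordD) * (-f) + (ζ : ℂ) • (f - f ζ • 1) := by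
      have : (coordD * f) ζ = ζ * f ζ := rfl
      rw [this, mul_smul]
      simp only [smul_sub, sub_mul, smul_mul_assoc, one_mul, mul_neg]
      abel
    rw [h1]
    refine N.topologicalClosure.add_mem (Submodule.le_topologicalClosure _ ?_)
      (N.topologicalClosure.smul_mem _ h)
    exact ⟨-f, discSub.neg_mem hf, rfl⟩
  · intro f g hf hg
    have : f + g - (f + g) ζ • 1 = (f - f ζ • 1) + (g - g ζ • 1) := by
      rw [ContinuousMap.add_apply, add_smul]; abel
    rw [this]
    exact N.topologicalClosure.add_mem hf hg
  · intro c f hf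
    have : c • f - (c • f) ζ • 1 = c • (f - f ζ • 1) := by
      rw [ContinuousMap.smul_apply, smul_eq_mul, mul_smul, smul_sub]
    rw [this]
    exact N.topologicalClosure.smul_mem _ hf

lemma exists_one_sub_mem {J : Set C(CD, ℂ)} (hJ : IsClosedIdealD J) {ζ : CD} {g : C(CD, ℂ)}
    (hg : g ∈ J) (hgζ : g ζ ≠ 0) :
    ∃ a ∈ discAlg, 1 - ((ζ : ℂ) • 1 - coordD) * a ∈ J := by
  set p := (g ζ)⁻¹ • g
  have hp : p ∈ J := hJ.smul_mem _ _ hg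
  have hpζ : p ζ = 1 := by simp [p, hgζ]
  have h1 := sub_const_mem_closure (ζ := ζ) (1 - p) (discSub.sub_mem discSub.one_mem (hJ.subset hp))
  rw [ContinuousMap.sub_apply, hpζ, ContinuousMap.one_apply, sub_self, zero_smul, sub_zero] at h1
  obtain ⟨_, ⟨b, hb, rfl⟩, hd⟩ := Metric.mem_closure_iff.1 h1 1 one_pos
  rw [LinearMap.mulLeft_apply] at hd
  set t := (1 - p) - ((ζ : ℂ) • 1 - coordD) * b
  have ht : ‖t‖ < 1 := by rwa [dist_eq_norm] at hd
  have htA : t ∈ discSub := discSub.sub_mem (discSub.sub_mem discSub.one_mem (hJ.subset hp))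
    (discSub.mul_mem (discSub.sub_mem (discSub.smul_mem discSub.one_mem _) coordD_mem) hb)
  have hinv := inverse_one_sub_mem isClosed_discSub htA ht
  have hmul : Ring.inverse (1 - t) * (1 - t) = 1 :=
    Ring.inverse_mul_cancel _ (Units.oneSub _ ht).isUnit
  refine ⟨Ring.inverse (1 - t) * b, discSub.mul_mem hinv hb, ?_⟩
  have h2 : 1 - ((ζ : ℂ) • 1 - coordD) * (Ring.inverse (1 - t) * b) = Ring.inverse (1 - t) * p := by
    have h3 : 1 - t = p + ((ζ : ℂ) • 1 - coordD) * b := by simp only [t]; ring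
    calc _ = Ring.inverse (1 - t) * (1 - t) -
          ((ζ : ℂ) • 1 - coordD) * (Ring.inverse (1 - t) * b) := by rw [hmul]
      _ = Ring.inverse (1 - t) * (p + ((ζ : ℂ) • 1 - coordD) * b) -
          ((ζ : ℂ) • 1 - coordD) * (Ring.inverse (1 - t) * b) := by rw [← h3]
      _ = _ := by ring
  rw [h2]
  exact hJ.mul_mem _ hinv _ hp

lemma integral_cker_mul_conj {W : Torus → ℂ} (hW : AnalyticOnCircle W) {w : ℂ} (hw : ‖w‖ < 1) :
    ∫ x, cker w x * starRingEnd ℂ (W x) ∂arcM = starRingEnd ℂ (∫ x, W x ∂arcM) := by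
  have h1 := hW.integral_res_mul (dker_mem hw)
  have h2 := dker_mul hw ⟨0, by simp⟩
  simp only [mul_zero, sub_zero, mul_one] at h2
  rw [h2, one_mul] at h1
  rw [← h1, ← integral_conj]
  congr 1; ext x
  rw [map_mul, res_dker hw, Complex.conj_conj]

lemma InnerGen.norm_cext_le {J : Set C(CD, ℂ)} (hJ : IsClosedIdealD J) {W : Torus → ℂ}
    (hW : InnerGen J W) {w : ℂ} (hw : ‖w‖ < 1) : ‖cext W w‖ ≤ 1 :=
  _root_.norm_cext_le (hW.lim.analyticOnCircle hJ.subset)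
    (hW.norm_eq.mono fun _ hx => hx.le) hw

/-- Off the common zeros of `J` the generating inner function has a holomorphic reciprocal. -/
lemma InnerGen.exists_reciprocal {J : Set C(CD, ℂ)} (hJ : IsClosedIdealD J) {W : Torus → ℂ}
    (hW : InnerGen J W) {ζ : CD} {g : C(CD, ℂ)} (hg : g ∈ J) (hgζ : g ζ ≠ 0) :
    ∃ U : Set ℂ, IsOpen U ∧ (ζ : ℂ) ∈ U ∧ ∃ q : ℂ → ℂ, DifferentiableOn ℂ q U ∧
      ∀ w ∈ U ∩ ball 0 1, cext W w * q w = 1 := by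
  obtain ⟨a, ha, haJ⟩ := exists_one_sub_mem hJ hg hgζ
  have hWi : Integrable (fun x => starRingEnd ℂ (W x)) arcM :=
    hW.lim.memLp.star.integrable (by norm_num)
  set U : Set ℂ := {w | ‖((ζ : ℂ) - w) • a‖ < 1}
  have hU : IsOpen U := isOpen_lt (by fun_prop) continuous_const
  let R : ℂ → C(CD, ℂ) := fun w => Ring.inverse (1 - ((ζ : ℂ) - w) • a)
  refine ⟨U, hU, by simp [U], fun w => starRingEnd ℂ (∫ x, W x ∂arcM) +
    pairing arcM _ hWi (res coordD * res a * res (R w)), ?_, ?_⟩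
  · intro w hw
    refine DifferentiableAt.differentiableWithinAt ?_
    have hR : DifferentiableAt ℂ R w :=
      DifferentiableAt.comp (f := fun w : ℂ => 1 - ((ζ : ℂ) - w) • a) w
        (differentiableAt_inverse (Units.oneSub _ hw).isUnit) (by fun_prop)
    let T : C(CD, ℂ) →L[ℂ] C(Torus, ℂ) := ⟨res.toLinearMap, continuous_res⟩
    have hT : DifferentiableAt ℂ (fun w => res (R w)) w := T.differentiableAt.comp w hR
    exact (differentiableAt_const _).add
      ((pairing arcM _ hWi).differentiableAt.comp w (hT.const_mul _))
  · rintro w ⟨hw, hwb⟩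
    have hw1 : ‖w‖ < 1 := mem_ball_zero_iff.1 hwb
    have hRA : R w ∈ discSub := inverse_one_sub_mem isClosed_discSub (discSub.smul_mem ha _) hw
    have hRm : R w * (1 - ((ζ : ℂ) - w) • a) = 1 :=
      Ring.inverse_mul_cancel _ (Units.oneSub _ hw).isUnit
    set j := R w * (1 - ((ζ : ℂ) • 1 - coordD) * a) with hj
    have hjJ : j ∈ J := hJ.mul_mem _ hRA _ haJ
    have hj' : j = 1 - (w • 1 - coordD) * (a * R w) := by
      have h1 : (1 : C(CD, ℂ)) - (w • 1 - coordD) * (a * R w) =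
          R w * (1 - ((ζ : ℂ) - w) • a) - (w • 1 - coordD) * (a * R w) := by rw [hRm]
      have h2 : ((ζ : ℂ) - w) • a = ((ζ : ℂ) • (1 : C(CD, ℂ)) - w • 1) * a := by
        rw [sub_mul, smul_mul_assoc, smul_mul_assoc, one_mul, sub_smul]
      rw [h1, h2, hj]; ring
    have hval : j ⟨w, by simpa using hw1.le⟩ = 1 := by
      rw [hj', ContinuousMap.sub_apply, ContinuousMap.mul_apply]
      have : (w • 1 - coordD : C(CD, ℂ)) ⟨w, by simpa using hw1.le⟩ = 0 := by
        simp [coordD]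
      rw [this]; simp
    have h3 := hW.eq_mul hJ hjJ hw1
    rw [hval] at h3
    rw [h3]
    congr 1
    beta_reduce
    rw [← integral_cker_mul_conj (hW.lim.analyticOnCircle hJ.subset) hw1, pairing_apply,
      ← integral_add (integrable_continuous_mul hWi _) (integrable_continuous_mul hWi _)]
    simp only [cext]
    congr 1; ext x
    have h4 := fourier_mul_cker hw1 x
    have h5 : res j x = 1 - (w - fourier 1 x) * (res a x * res (R w) x) := by
      rw [hj']
      simp only [map_sub, map_mul, map_smul, map_one, res_coordD, ContinuousMap.sub_apply,
        ContinuousMap.mul_apply, ContinuousMap.smul_apply, ContinuousMap.one_apply, smul_eq_mul,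
        mul_one]
    rw [h5, res_coordD, ContinuousMap.mul_apply, ContinuousMap.mul_apply]
    linear_combination -(res a x * res (R w) x * starRingEnd ℂ (W x)) * h4

lemma InnerGen.exists_continuation {J : Set C(CD, ℂ)} (hJ : IsClosedIdealD J) {W : Torus → ℂ}
    (hW : InnerGen J W) {ζ : CD} {g : C(CD, ℂ)} (hg : g ∈ J) (hgζ : g ζ ≠ 0) :
    ∃ U : Set ℂ, IsOpen U ∧ (ζ : ℂ) ∈ U ∧ ∃ q : ℂ → ℂ, DifferentiableOn ℂ q U ∧
      ∀ w ∈ U ∩ ball 0 1, q w = cext W w := by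
  obtain ⟨U, hU, hζU, q, hq, hqW⟩ := hW.exists_reciprocal hJ hg hgζ
  have h1 : ∀ w ∈ U ∩ ball 0 1, 1 ≤ ‖q w‖ := fun w hw => by
    have h2 := congrArg norm (hqW w hw)
    rw [norm_mul, norm_one] at h2
    rw [← h2]
    exact mul_le_of_le_one_left (norm_nonneg _) (hW.norm_cext_le hJ (mem_ball_zero_iff.1 hw.2))
  have hcl : (ζ : ℂ) ∈ closure (U ∩ ball 0 1) :=
    hU.inter_closure ⟨hζU, by rw [closure_ball _ one_ne_zero]; exact ζ.2⟩
  have hqc : ContinuousAt q ζ := hq.continuousOn.continuousAt (hU.mem_nhds hζU)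
  have hqζ : 1 ≤ ‖q ζ‖ := by
    have := mem_closure_iff_nhdsWithin_neBot.1 hcl
    exact ge_of_tendsto (hqc.norm.mono_left nhdsWithin_le_nhds)
      (eventually_nhdsWithin_of_forall h1)
  refine ⟨U ∩ q ⁻¹' {0}ᶜ, hq.continuousOn.isOpen_inter_preimage hU isOpen_compl_singleton,
    ⟨hζU, fun h => ?_⟩, fun w => (q w)⁻¹, (hq.mono inter_subset_left).inv fun w hw => hw.2, ?_⟩
  · have h' : q ζ = 0 := h
    rw [h', norm_zero] at hqζ
    linarith
  · rintro w ⟨⟨hwU, -⟩, hwb⟩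
    exact (eq_inv_of_mul_eq_one_left (hqW w ⟨hwU, hwb⟩)).symm

lemma exists_seq_tendsto_dilC {F : Torus → ℂ} (hF : L2Lim discAlg F) :
    ∃ ns : ℕ → ℕ, StrictMono ns ∧
      ∀ᵐ x ∂arcM, Tendsto (fun i => dilC F (ns i) x) atTop (𝓝 (F x)) :=
  (tendstoInMeasure_of_tendsto_eLpNorm (by norm_num)
    (fun n => (continuous_dilC (hF.memLp.integrable (by norm_num)) n).aestronglyMeasurable)
    hF.memLp.1 hF.tendsto_dilC).exists_seq_tendsto_ae

lemma InnerGen.tendsto_norm_cext {J : Set C(CD, ℂ)} (hJ : IsClosedIdealD J) {W : Torus → ℂ}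
    (hW : InnerGen J W) {f : C(CD, ℂ)} (hf : f ∈ J) (hf0 : f ≠ 0) :
    ∀ᵐ x ∂arcM, Tendsto (fun r : ℝ => ‖cext W (r * (bdry x : CD))‖) (𝓝[<] 1) (𝓝 1) := by
  obtain ⟨ns, hns, hlim⟩ := exists_seq_tendsto_dilC (hW.lim.mono hJ.subset)
  have hnull : ∀ᵐ x ∂arcM, ¬ ∀ g ∈ J, res g x = 0 := by
    rw [ae_iff]
    simpa only [not_not] using measure_commonZeros_eq_zero hJ hf hf0
  filter_upwards [hlim, hnull, hW.norm_eq] with x hx hne hx1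
  push Not at hne
  obtain ⟨g, hg, hgx⟩ := hne
  obtain ⟨U, hU, hxU, q, hq, hqW⟩ := hW.exists_continuation hJ hg (ζ := bdry x) hgx
  have hqc : ContinuousAt q (bdry x : CD) := hq.continuousOn.continuousAt (hU.mem_nhds hxU)
  have hray : Tendsto (fun r : ℝ => (r : ℂ) * (bdry x : CD)) (𝓝[<] 1) (𝓝 (bdry x : CD)) := by
    have : Continuous fun r : ℝ => (r : ℂ) * (bdry x : CD) := by fun_prop
    simpa using this.continuousAt.tendsto.mono_left (nhdsWithin_le_nhds (a := (1 : ℝ)))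
  have hnorm : ‖((bdry x : CD) : ℂ)‖ = 1 := Circle.norm_coe _
  have hcont : Tendsto (fun r : ℝ => cext W (r * (bdry x : CD))) (𝓝[<] 1)
      (𝓝 (q (bdry x : CD))) := by
    refine (hqc.tendsto.comp hray).congr' ?_
    filter_upwards [hray.eventually (hU.mem_nhds hxU), self_mem_nhdsWithin,
      nhdsWithin_le_nhds (lt_mem_nhds (zero_lt_one (α := ℝ)))] with r hrU hr1 hr0
    refine hqW _ ⟨hrU, mem_ball_zero_iff.2 ?_⟩
    rw [norm_mul, hnorm, mul_one, Complex.norm_real, Real.norm_of_nonneg hr0.le]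
    exact hr1
  have hrad : Tendsto rad atTop (𝓝[<] 1) :=
    tendsto_nhdsWithin_iff.2 ⟨tendsto_rad, Eventually.of_forall rad_lt_one⟩
  have heq : q (bdry x : CD) = W x :=
    tendsto_nhds_unique ((hcont.comp hrad).comp hns.tendsto_atTop) hx
  rw [heq] at hcont
  simpa only [hx1] using hcont.norm

lemma InnerGen.isInner {J : Set C(CD, ℂ)} (hJ : IsClosedIdealD J) {W : Torus → ℂ}
    (hW : InnerGen J W) {f : C(CD, ℂ)} (hf : f ∈ J) (hf0 : f ≠ 0) : IsInner (cext W) := by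
  refine ⟨isHinf_cext (hW.lim.analyticOnCircle hJ.subset)
    (hW.norm_eq.mono fun _ hx => hx.le), ?_⟩
  filter_upwards [ae_restrict_Ico_of_ae_arcM (hW.tendsto_norm_cext hJ hf hf0)] with θ hθ
  simpa only [coe_bdry_mk] using hθ

/-- Carleson–Rudin: every nonzero closed ideal of the disc algebra is
of the form `ωH^∞ ∩ I(K)` for an inner function `ω` and a closed boundary set `K` of
Lebesgue measure zero containing the support of `ω`. -/
theorem stmt17 (J : Set C(CD, ℂ)) (hJ : IsClosedIdealD J) (hJne : J ≠ {0}) :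
    ∃ ω : ℂ → ℂ, IsInner ω ∧
      ∃ K : Set ℂ, IsClosed K ∧ K ⊆ Metric.sphere (0 : ℂ) 1 ∧
        volume {θ : ℝ | θ ∈ Set.Ico 0 (2 * Real.pi) ∧
          Complex.exp (θ * Complex.I) ∈ K} = 0 ∧
        innerSupport ω ⊆ K ∧
        J = {f : C(CD, ℂ) | f ∈ discAlg ∧
              (∀ ζ : CD, (ζ : ℂ) ∈ K → f ζ = 0) ∧
              ∃ h : ℂ → ℂ, IsHinf h ∧
                ∀ z, ∀ hz : z ∈ Metric.ball (0 : ℂ) 1,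
                  f ⟨z, Metric.ball_subset_closedBall hz⟩ = ω z * h z} := by
  obtain ⟨f, hf, hf0⟩ : ∃ f ∈ J, f ≠ 0 := by
    by_contra! h
    exact hJne (Subset.antisymm (fun f hf => h f hf) (singleton_subset_iff.2 hJ.zero_mem))
  obtain ⟨W, hlim, hnorm, han⟩ := exists_unimodular hJ hf hf0
  have hW : InnerGen J W := ⟨hlim, hnorm, han⟩
  set Z : Set Torus := {x | ∀ g ∈ J, res g x = 0} with hZ
  have hZc : IsClosed Z := by
    have : Z = ⋂ g ∈ J, {x | res g x = 0} := by ext; simp [hZ]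
    rw [this]
    exact isClosed_biInter fun g _ => isClosed_eq (res g).continuous continuous_const
  have hmem : ∀ x, ((bdry x : CD) : ℂ) ∈ (fun x => ((bdry x : CD) : ℂ)) '' Z → x ∈ Z := by
    rintro x ⟨y, hy, hyx⟩ g hg
    have : bdry y = bdry x := Subtype.ext hyx
    rw [← hy g hg, res_apply, res_apply, this]
  refine ⟨cext W, hW.isInner hJ hf hf0, (fun x => ((bdry x : CD) : ℂ)) '' Z, ?_, ?_, ?_, ?_, ?_⟩
  · exact (hZc.isCompact.image (by fun_prop)).isClosed
  · rintro _ ⟨x, -, rfl⟩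
    exact mem_sphere_zero_iff_norm.2 (Circle.norm_coe _)
  · have hnull : ∀ᵐ x ∂arcM, x ∉ Z := by
      rw [ae_iff]
      simp only [not_not]
      exact measure_commonZeros_eq_zero hJ hf hf0
    have h1 := (ae_restrict_iff' measurableSet_Ico).1 (ae_restrict_Ico_of_ae_arcM hnull)
    refine measure_mono_null ?_ (ae_iff.1 h1)
    rintro θ ⟨hθ, hθK⟩ h
    rw [← coe_bdry_mk] at hθK
    exact h hθ (hmem _ hθK)
  · rintro ζ ⟨hζ, hsing⟩
    have hζ1 : ‖ζ‖ = 1 := mem_sphere_zero_iff_norm.1 hζ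
    obtain ⟨x, hx⟩ := exists_bdry_eq ⟨ζ, sphere_subset_closedBall hζ⟩ hζ1
    refine ⟨x, fun g hg => ?_, congrArg Subtype.val hx⟩
    by_contra hgx
    rw [res_apply, hx] at hgx
    exact hsing (hW.exists_continuation hJ hg hgx)
  · ext j
    constructor
    · intro hj
      refine ⟨hJ.subset hj, ?_, _, hW.isHinf_quotient hj, fun z hz =>
        hW.eq_mul hJ hj (mem_ball_zero_iff.1 hz)⟩
      rintro ζ ⟨x, hx, hxζ⟩
      have : bdry x = ζ := Subtype.ext hxζ
      rw [← this]
      exact hx j hj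
    · rintro ⟨hjA, hjK, h, hh, heq⟩
      exact L2Lim.mem_of_vanish hJ hjA
        (hW.l2Lim_of_eq_mul hJ hh fun w hw => heq w (mem_ball_zero_iff.2 hw))
        fun x hx => hjK _ ⟨x, hx, rfl⟩

end
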